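/- arXiv:2106.09452 — 4 statements merged into one kernel-verified Lean document; each statement's English description precedes it below -/
import Mathlib

section
/- Fix α > 0 and let {a_N}_{N ≥ 2} be positive reals with a_N/√(N−1) → α as N → ∞. Then there exists N₀ ∈ ℕ such that for all N ≥ N₀ and all r ∈ (−a_N, a_N), w_{N,a_N}(r) ≤ (√π α)^{−1} e^{−r²/(4α²)}. -/
open Filter MeasureTheory

/-- `s_{N,a}(r) = 1 − r²/a²` (independent of `N`). -/
noncomputable def sFun (a r : ℝ) : ℝ := 1 - r ^ 2 / a ^ 2

/-- The normalized weight `w_{N,a}(r) = s_{N,a}(r)^{N/2−1} / ∫_{−a}^{a} s_{N,a}(ρ)^{N/2−1} dρ`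
for `r ∈ (−a,a)`, and `0` for `|r| ≥ a`. -/
noncomputable def wFun (N : ℕ) (a r : ℝ) : ℝ :=
  if |r| < a then
    sFun a r ^ ((N : ℝ) / 2 - 1) / ∫ ρ in Set.Ioo (-a) a, sFun a ρ ^ ((N : ℝ) / 2 - 1)
  else 0

/-- The Gaussian weight `w_∞(r) = (2π)^{−1/2} α^{−1} e^{−r²/(2α²)}`. -/
noncomputable def wInf (α r : ℝ) : ℝ :=
  (Real.sqrt (2 * Real.pi) * α)⁻¹ * Real.exp (-r ^ 2 / (2 * α ^ 2))


lemma exists_R_aux (α : ℝ) (hα : 0 < α) : ∃ R : ℝ, 0 < R ∧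
    Real.sqrt Real.pi * α < ∫ ρ in (-R)..R, Real.exp (-(3 / (4 * α ^ 2)) * ρ ^ 2) := by
  have hc : 0 < 3 / (4 * α ^ 2) := by positivity
  have h := intervalIntegral_tendsto_integral (integrable_exp_neg_mul_sq hc)
    tendsto_neg_atTop_atBot tendsto_id
  rw [integral_gaussian] at h
  have hlt : Real.sqrt Real.pi * α < Real.sqrt (Real.pi / (3 / (4 * α ^ 2))) := by
    apply Real.lt_sqrt_of_sq_lt
    rw [mul_pow, Real.sq_sqrt Real.pi_pos.le]
    have : Real.pi / (3 / (4 * α ^ 2)) = Real.pi * α ^ 2 * (4 / 3) := by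
      field_simp
    rw [this]
    have : 0 < Real.pi * α ^ 2 := by have := Real.pi_pos; positivity
    linarith
  obtain ⟨R, h1, h2⟩ := ((h.eventually_const_lt hlt).and (eventually_gt_atTop 0)).exists
  exact ⟨R, h2, h1⟩

lemma pow_lower_aux (p c b R ρ : ℝ) (hp : 0 ≤ p) (hc : 0 < c) (hR : 0 < R) (hb : R < b)
    (h : p ≤ c * (b ^ 2 - R ^ 2)) (hρ : |ρ| ≤ R) :
    Real.exp (-c * ρ ^ 2) ≤ sFun b ρ ^ p := by
  have h1 : ρ ^ 2 ≤ R ^ 2 := sq_le_sq' (abs_le.1 hρ).1 (abs_le.1 hρ).2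
  have h2 : 0 < b ^ 2 - ρ ^ 2 := by nlinarith
  have hb0 : 0 < b := hR.trans hb
  have hs : sFun b ρ = (b ^ 2 - ρ ^ 2) / b ^ 2 := by
    unfold sFun; field_simp
  have hs0 : 0 < sFun b ρ := by rw [hs]; positivity
  rw [Real.rpow_def_of_pos hs0, Real.exp_le_exp]
  have hl := Real.one_sub_inv_le_log_of_pos hs0
  have he : 1 - (sFun b ρ)⁻¹ = -(ρ ^ 2 / (b ^ 2 - ρ ^ 2)) := by
    rw [hs]; field_simp; ring
  rw [he] at hl
  have h3 : ρ ^ 2 / (b ^ 2 - ρ ^ 2) * p ≤ c * ρ ^ 2 := by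
    rw [div_mul_eq_mul_div, div_le_iff₀ h2]
    have : p ≤ c * (b ^ 2 - ρ ^ 2) := h.trans (by gcongr)
    nlinarith [mul_le_mul_of_nonneg_left this (sq_nonneg ρ)]
  nlinarith [mul_le_mul_of_nonneg_right hl hp]

lemma integral_lower_aux (p c b R : ℝ) (hp : 0 ≤ p) (hc : 0 < c) (hR : 0 < R) (hb : R < b)
    (h : p ≤ c * (b ^ 2 - R ^ 2)) :
    ∫ ρ in (-R)..R, Real.exp (-c * ρ ^ 2) ≤ ∫ ρ in Set.Ioo (-b) b, sFun b ρ ^ p := by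
  have hcont : Continuous (fun ρ => sFun b ρ ^ p) := by
    unfold sFun
    exact Continuous.rpow_const (by fun_prop) (fun _ => Or.inr hp)
  have hcont2 : Continuous (fun ρ : ℝ => Real.exp (-c * ρ ^ 2)) := by fun_prop
  have hb0 : 0 < b := hR.trans hb
  rw [intervalIntegral.integral_of_le (by linarith)]
  calc ∫ ρ in Set.Ioc (-R) R, Real.exp (-c * ρ ^ 2)
      ≤ ∫ ρ in Set.Ioc (-R) R, sFun b ρ ^ p := by
        apply setIntegral_mono_on hcont2.integrableOn_Ioc hcont.integrableOn_Ioc measurableSet_Ioc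
        intro x hx
        exact pow_lower_aux p c b R x hp hc hR hb h (abs_le.2 ⟨hx.1.le, hx.2⟩)
    _ ≤ _ := by
        apply setIntegral_mono_set (hcont.integrableOn_Icc.mono_set Set.Ioo_subset_Icc_self)
        · filter_upwards [ae_restrict_mem measurableSet_Ioo] with x hx
          apply Real.rpow_nonneg
          unfold sFun
          have : x ^ 2 / b ^ 2 ≤ 1 := by
            rw [div_le_one (by positivity)]
            exact sq_le_sq' hx.1.le hx.2.le
          linarith
        · apply HasSubset.Subset.eventuallyLE
          intro x hx
          exact ⟨by linarith [hx.1], by linarith [hx.2]⟩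

/-- if `a_N/√(N−1) → α`, then for all large `N` and all `r ∈ (−a_N, a_N)`,
`w_{N,a_N}(r) ≤ (√π α)⁻¹ e^{−r²/(4α²)}`. -/
theorem weight_uniform_gaussian_bound
    (α : ℝ) (hα : 0 < α) (a : ℕ → ℝ) (ha : ∀ N, 2 ≤ N → 0 < a N)
    (hlim : Tendsto (fun N : ℕ => a N / Real.sqrt ((N : ℝ) - 1)) atTop (nhds α)) :
    ∃ N₀ : ℕ, ∀ N, N₀ ≤ N → ∀ r : ℝ, |r| < a N →
      wFun N (a N) r ≤ (Real.sqrt Real.pi * α)⁻¹ * Real.exp (-r ^ 2 / (4 * α ^ 2)) := by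
  obtain ⟨R, hR, hRI⟩ := exists_R_aux α hα
  have hα2 : 0 < α ^ 2 := by positivity
  have hsq := hlim.pow 2
  have e1 := hsq.eventually_lt_const (show α ^ 2 < 3 / 2 * α ^ 2 by linarith)
  have e2 := hsq.eventually_const_lt (show 5 / 6 * α ^ 2 < α ^ 2 by linarith)
  have e3 := (tendsto_natCast_atTop_atTop (R := ℝ)).eventually_ge_atTop (6 * R ^ 2 / α ^ 2 + 1)
  obtain ⟨N₀, hN₀⟩ := eventually_atTop.1 ((e1.and e2).and (e3.and (eventually_ge_atTop 5)))
  refine ⟨N₀, fun N hN r hr => ?_⟩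
  obtain ⟨⟨h1, h2⟩, h3, h5⟩ := hN₀ N hN
  have h5' : (5 : ℝ) ≤ N := by exact_mod_cast h5
  have hb0 : 0 < a N := ha N (by omega)
  generalize a N = b at *
  have hN1 : (0 : ℝ) < (N : ℝ) - 1 := by linarith
  rw [div_pow, Real.sq_sqrt hN1.le] at h1 h2
  rw [div_lt_iff₀ hN1] at h1
  rw [lt_div_iff₀ hN1] at h2
  have h3' : 6 * R ^ 2 ≤ ((N : ℝ) - 1) * α ^ 2 := by
    rw [← div_le_iff₀ hα2]; linarith
  have hRb : R < b := by
    apply lt_of_pow_lt_pow_left₀ 2 hb0.le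
    nlinarith
  have hp : 0 ≤ (N : ℝ) / 2 - 1 := by linarith
  have hpc : (N : ℝ) / 2 - 1 ≤ 3 / (4 * α ^ 2) * (b ^ 2 - R ^ 2) := by
    rw [div_mul_eq_mul_div, le_div_iff₀ (by positivity)]
    nlinarith
  have hZ := integral_lower_aux _ _ b R hp (by positivity : 0 < 3 / (4 * α ^ 2)) hR hRb hpc
  have hK : 0 < Real.sqrt Real.pi * α := mul_pos (Real.sqrt_pos.2 Real.pi_pos) hα
  have hZ' := hRI.le.trans hZ
  have hr2 : r ^ 2 < b ^ 2 := sq_lt_sq' (abs_lt.1 hr).1 (abs_lt.1 hr).2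
  have hs0 : 0 < sFun b r := by
    unfold sFun
    have : r ^ 2 / b ^ 2 < 1 := by rw [div_lt_one (by positivity)]; exact hr2
    linarith
  have hnum : sFun b r ^ ((N : ℝ) / 2 - 1) ≤ Real.exp (-r ^ 2 / (4 * α ^ 2)) := by
    rw [Real.rpow_def_of_pos hs0, Real.exp_le_exp]
    have hl := Real.log_le_sub_one_of_pos hs0
    have hl' : Real.log (sFun b r) ≤ -(r ^ 2 / b ^ 2) := by
      unfold sFun at hl ⊢; linarith
    refine (mul_le_mul_of_nonneg_right hl' hp).trans ?_
    have : r ^ 2 / (4 * α ^ 2) ≤ r ^ 2 / b ^ 2 * ((N : ℝ) / 2 - 1) := by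
      rw [div_mul_eq_mul_div, div_le_div_iff₀ (by positivity) (by positivity), mul_assoc]
      apply mul_le_mul_of_nonneg_left _ (sq_nonneg r)
      nlinarith
    rw [neg_div]; linarith
  unfold wFun
  rw [if_pos hr, inv_mul_eq_div]
  exact div_le_div₀ (Real.exp_pos _).le hnum hK hZ'
end

section
/- Fix N ∈ ℕ with N ≥ 2, a > 0, c ∈ (−a, a) and λ ∈ ℝ. Let h : [c, a] → ℝ be continuously differentiable on [c, a] and twice continuously differentiable on (c, a), with h(c) = 0, and suppose h satisfies the ODE s_{N,a}(r) h''(r) − (N r / a²) h'(r) = −λ h(r) for all r ∈ (c, a). Then λ ∫_c^a h(r)² w_{N,a}(r) dr = ∫_c^a h'(r)² s_{N,a}(r) w_{N,a}(r) dr. -/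
open Filter MeasureTheory

/-- integration by parts for the Sturm–Liouville operator
`L_N h = s_{N,a} h'' − (Nr/a²) h'`: if `h(c) = 0` and `L_N h = −λ h` on `(c,a)`, then
`λ ∫_c^a h² w_{N,a} = ∫_c^a (h')² s_{N,a} w_{N,a}`. -/
theorem sturm_liouville_integration_by_parts
    (N : ℕ) (hN : 2 ≤ N) (a : ℝ) (ha : 0 < a) (c : ℝ) (hc : c ∈ Set.Ioo (-a) a)
    (lam : ℝ) (h : ℝ → ℝ)
    (h1 : ContDiffOn ℝ 1 h (Set.Icc c a))
    (h2 : ContDiffOn ℝ 2 h (Set.Ioo c a))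
    (hbc : h c = 0)
    (hode : ∀ r ∈ Set.Ioo c a,
      sFun a r * deriv (deriv h) r - ((N : ℝ) * r / a ^ 2) * deriv h r = -lam * h r) :
    lam * ∫ r in Set.Ioo c a, h r ^ 2 * wFun N a r
      = ∫ r in Set.Ioo c a, (deriv h r) ^ 2 * sFun a r * wFun N a r := by
  obtain ⟨hc1, hc2⟩ := hc
  set g : ℝ → ℝ := derivWithin h (Set.Icc c a) with hg
  set p : ℝ := (N : ℝ) / 2 with hp
  have hN' : (2 : ℝ) ≤ N := by exact_mod_cast hN
  have hp1 : 0 ≤ p - 1 := by rw [hp]; linarith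
  have hp0 : 0 < p := by linarith
  have hgc : ContinuousOn g (Set.Icc c a) :=
    h1.continuousOn_derivWithin (uniqueDiffOn_Icc hc2) le_rfl
  have hhc : ContinuousOn h (Set.Icc c a) := h1.continuousOn
  have hgd : ∀ r ∈ Set.Ioo c a, g r = deriv h r := fun r hr =>
    derivWithin_of_mem_nhds (Icc_mem_nhds hr.1 hr.2)
  have hsc : Continuous (sFun a) := by
    unfold sFun
    fun_prop
  have hspos : ∀ r ∈ Set.Ioo c a, 0 < sFun a r := by
    intro r hr
    have : r ^ 2 < a ^ 2 := by nlinarith [hr.1, hr.2]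
    have : r ^ 2 / a ^ 2 < 1 := (div_lt_one (by positivity)).2 this
    unfold sFun
    linarith
  have hsa : sFun a a = 0 := by
    unfold sFun
    rw [div_self (by positivity)]
    ring
  have hpc : Continuous (fun r => sFun a r ^ p) := hsc.rpow_const (fun _ => Or.inr hp0.le)
  have hp1c : Continuous (fun r => sFun a r ^ (p - 1)) := hsc.rpow_const (fun _ => Or.inr hp1)
  have hsd : ∀ r, HasDerivAt (sFun a) (-(2 * r / a ^ 2)) r := by
    intro r
    have := ((hasDerivAt_pow 2 r).div_const (a ^ 2)).const_sub 1
    have e : sFun a = fun x => 1 - x ^ 2 / a ^ 2 := rfl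
    rw [e]
    refine HasDerivAt.congr_deriv this ?_
    simp
  have hI1 : IntervalIntegrable (fun r => g r ^ 2 * sFun a r ^ p) volume c a := by
    apply ContinuousOn.intervalIntegrable_of_Icc hc2.le
    exact (hgc.pow 2).mul hpc.continuousOn
  have hI2 : IntervalIntegrable (fun r => lam * (h r ^ 2 * sFun a r ^ (p - 1))) volume c a := by
    apply ContinuousOn.intervalIntegrable_of_Icc hc2.le
    exact continuousOn_const.mul ((hhc.pow 2).mul hp1c.continuousOn)
  have key := intervalIntegral.integral_eq_sub_of_hasDerivAt_of_le hc2.le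
    (f := fun r => h r * g r * sFun a r ^ p)
    (f' := fun r => g r ^ 2 * sFun a r ^ p - lam * (h r ^ 2 * sFun a r ^ (p - 1)))
    ((hhc.mul hgc).mul hpc.continuousOn) (by
      intro r hr
      have hnh : Set.Ioo c a ∈ nhds r := Ioo_mem_nhds hr.1 hr.2
      have hdh : HasDerivAt h (deriv h r) r :=
        ((h2.contDiffAt hnh).differentiableAt (by norm_num)).hasDerivAt
      have hd2 : ContDiffOn ℝ 1 (deriv h) (Set.Ioo c a) :=
        h2.deriv_of_isOpen isOpen_Ioo (by norm_num)
      have hdd : HasDerivAt (deriv h) (deriv (deriv h) r) r :=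
        ((hd2.contDiffAt hnh).differentiableAt (by norm_num)).hasDerivAt
      have hdg : HasDerivAt g (deriv (deriv h) r) r :=
        hdd.congr_of_eventuallyEq (Filter.eventuallyEq_of_mem hnh hgd)
      have hds := (hsd r).rpow_const (p := p) (Or.inl (hspos r hr).ne')
      have := (hdh.mul hdg).mul hds
      refine HasDerivAt.congr_deriv this ?_
      have e : sFun a r ^ p = sFun a r * sFun a r ^ (p - 1) := by
        rw [Real.rpow_sub_one (hspos r hr).ne']
        field_simp [(hspos r hr).ne']
      have ho := hode r hr
      have hNp : (N : ℝ) = 2 * p := by rw [hp]; ring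
      rw [hNp] at ho
      rw [Pi.mul_apply, e, hgd r hr]
      linear_combination ((h r * sFun a r ^ (p - 1))) * ho) (hI1.sub hI2)
  rw [intervalIntegral.integral_sub hI1 hI2, hsa, hbc, Real.zero_rpow hp0.ne',
    intervalIntegral.integral_const_mul, intervalIntegral.integral_of_le hc2.le,
    intervalIntegral.integral_of_le hc2.le, integral_Ioc_eq_integral_Ioo,
    integral_Ioc_eq_integral_Ioo] at key
  set Z := ∫ ρ in Set.Ioo (-a) a, sFun a ρ ^ (p - 1) with hZ
  have hw : ∀ r ∈ Set.Ioo c a, wFun N a r = sFun a r ^ (p - 1) / Z := by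
    intro r hr
    unfold wFun
    rw [if_pos (abs_lt.2 ⟨hc1.trans hr.1, hr.2⟩)]
  have eL : ∫ r in Set.Ioo c a, h r ^ 2 * wFun N a r
      = (∫ r in Set.Ioo c a, h r ^ 2 * sFun a r ^ (p - 1)) / Z := by
    rw [← integral_div]
    refine setIntegral_congr_fun measurableSet_Ioo (fun r hr => ?_)
    simp only [hw r hr]
    ring
  have eR : ∫ r in Set.Ioo c a, (deriv h r) ^ 2 * sFun a r * wFun N a r
      = (∫ r in Set.Ioo c a, g r ^ 2 * sFun a r ^ p) / Z := by
    rw [← integral_div]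
    refine setIntegral_congr_fun measurableSet_Ioo (fun r hr => ?_)
    have e : sFun a r ^ p = sFun a r * sFun a r ^ (p - 1) := by
      rw [Real.rpow_sub_one (hspos r hr).ne']
      field_simp [(hspos r hr).ne']
    simp only [hw r hr, hgd r hr, e]
    ring
  rw [eL, eR, ← mul_div_assoc]
  congr 1
  linarith
end

section
/- Fix N ∈ ℕ with N ≥ 2, a > 0, c ∈ (−a, a) and λ ∈ ℝ. Let h : [c, a] → ℝ be continuously differentiable on [c, a] and twice continuously differentiable on (c, a), with h(c) = 0, satisfying s_{N,a}(r) h''(r) − (N r / a²) h'(r) = −λ h(r) on (c, a), and normalized so that ∫_c^a h(r)² w_{N,a}(r) dr = 1 (so that λ = ∫_c^a h'(r)² s_{N,a}(r) w_{N,a}(r) dr). Then ∫_c^a r² h(r)² w_{N,a}(r) dr ≤ (2a²/N) (1 + 2a²λ/N). -/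
open Filter MeasureTheory

/-- for a normalized solution `h` of the Sturm–Liouville problem
`s_{N,a} h'' − (Nr/a²) h' = −λ h` on `(c,a)` with `h(c) = 0` and `∫_c^a h² w_{N,a} = 1`
(so that `λ = ∫_c^a (h')² s_{N,a} w_{N,a}`), one has
`∫_c^a r² h(r)² w_{N,a}(r) dr ≤ (2a²/N)(1 + 2a²λ/N)`. -/
theorem second_moment_bound
    (N : ℕ) (hN : 2 ≤ N) (a : ℝ) (ha : 0 < a) (c : ℝ) (hc : c ∈ Set.Ioo (-a) a)
    (lam : ℝ) (h : ℝ → ℝ)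
    (h1 : ContDiffOn ℝ 1 h (Set.Icc c a))
    (h2 : ContDiffOn ℝ 2 h (Set.Ioo c a))
    (hbc : h c = 0)
    (hode : ∀ r ∈ Set.Ioo c a,
      sFun a r * deriv (deriv h) r - ((N : ℝ) * r / a ^ 2) * deriv h r = -lam * h r)
    (hnorm : ∫ r in Set.Ioo c a, h r ^ 2 * wFun N a r = 1)
    (hlam : lam = ∫ r in Set.Ioo c a, (deriv h r) ^ 2 * sFun a r * wFun N a r) :
    ∫ r in Set.Ioo c a, r ^ 2 * h r ^ 2 * wFun N a r
      ≤ (2 * a ^ 2 / N) * (1 + 2 * a ^ 2 * lam / N) := by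
  obtain ⟨hca, hca'⟩ := hc
  have hNp : (0:ℝ) < N := by exact_mod_cast (by omega : 0 < N)
  have hN2 : (2:ℝ) ≤ N := by exact_mod_cast hN
  set p : ℝ := (N : ℝ) / 2 - 1 with hp
  have hp0 : 0 ≤ p := by rw [hp]; linarith
  set Z : ℝ := ∫ ρ in Set.Ioo (-a) a, sFun a ρ ^ p with hZ
  have hsIoo : ∀ r ∈ Set.Ioo (-a) a, 0 < sFun a r := by
    intro r hr
    unfold sFun
    have : r ^ 2 < a ^ 2 := by nlinarith [hr.1, hr.2]
    have := (div_lt_one (by positivity : 0 < a ^ 2)).2 this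
    linarith
  have hs1 : ∀ r, sFun a r ≤ 1 := by
    intro r
    unfold sFun
    have : 0 ≤ r ^ 2 / a ^ 2 := by positivity
    linarith
  have hZ0 : 0 ≤ Z := by
    apply setIntegral_nonneg measurableSet_Ioo
    intro r hr
    exact Real.rpow_nonneg (hsIoo r hr).le _
  have hsub : ∀ r ∈ Set.Ioo c a, r ∈ Set.Ioo (-a) a := fun r hr => ⟨by linarith [hr.1], hr.2⟩
  set W : ℝ → ℝ := fun r => sFun a r ^ p with hW
  have hw : ∀ r ∈ Set.Ioo c a, wFun N a r = W r * Z⁻¹ := by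
    intro r hr
    have h' := hsub r hr
    unfold wFun
    rw [if_pos (abs_lt.2 h'), div_eq_mul_inv]
  have hscont : Continuous (sFun a) := by unfold sFun; fun_prop
  have hWc : Continuous W := hscont.rpow_const (fun _ => Or.inr hp0)
  have hW1c : Continuous (fun r => sFun a r ^ (p + 1)) :=
    hscont.rpow_const (fun _ => Or.inr (by linarith))
  set g : ℝ → ℝ := derivWithin h (Set.Icc c a) with hg
  have hgc : ContinuousOn g (Set.Icc c a) :=
    h1.continuousOn_derivWithin (uniqueDiffOn_Icc hca') le_rfl
  have hhc : ContinuousOn h (Set.Icc c a) := h1.continuousOn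
  have hgd : ∀ r ∈ Set.Ioo c a, HasDerivAt h (g r) r := by
    intro r hr
    have := (h1.differentiableOn (by norm_num) r (Set.Ioo_subset_Icc_self hr)).hasDerivWithinAt
    exact this.hasDerivAt (Icc_mem_nhds hr.1 hr.2)
  set F' : ℝ → ℝ := fun r => (h r ^ 2 + 2 * r * h r * g r) * (sFun a r * W r)
    - (N / a ^ 2) * (r ^ 2 * h r ^ 2 * W r) with hF'
  have hWc' := hWc.continuousOn (s := Set.Icc c a)
  have hsc' := hscont.continuousOn (s := Set.Icc c a)
  have hF'c : ContinuousOn F' (Set.Icc c a) := by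
    rw [hF']; fun_prop
  have hA : ContinuousOn (fun r => h r ^ 2 * W r) (Set.Icc c a) := by fun_prop
  have hB : ContinuousOn (fun r => g r ^ 2 * sFun a r * W r) (Set.Icc c a) := by fun_prop
  have hM : ContinuousOn (fun r => r ^ 2 * h r ^ 2 * W r) (Set.Icc c a) := by fun_prop
  have hint : ∀ f : ℝ → ℝ, ContinuousOn f (Set.Icc c a) → IntegrableOn f (Set.Ioo c a) :=
    fun f hf => (hf.integrableOn_Icc).mono_set Set.Ioo_subset_Icc_self
  have hsW : ∀ r ∈ Set.Ioo c a, sFun a r ^ (p + 1) = sFun a r * W r := by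
    intro r hr
    rw [Real.rpow_add_one (hsIoo r (hsub r hr)).ne', mul_comm]
  have hFz : ∫ r in Set.Ioo c a, F' r = 0 := by
    have key := intervalIntegral.integral_eq_sub_of_hasDerivAt_of_le (a := c) (b := a) hca'.le
      (f := fun r => r * h r ^ 2 * sFun a r ^ (p + 1)) (f' := F')
      (by have := hW1c.continuousOn (s := Set.Icc c a); fun_prop)
      (by
        intro r hr
        have hs0 := (hsIoo r (hsub r hr)).ne'
        have d1 : HasDerivAt (sFun a) (-(2 * r / a ^ 2)) r := by
          unfold sFun
          have := ((hasDerivAt_pow 2 r).div_const (a ^ 2)).const_sub 1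
          simpa using this
        have d2 := d1.rpow_const (p := p + 1) (Or.inl hs0)
        have d3 := ((hasDerivAt_id r).mul ((hgd r hr).pow 2)).mul d2
        refine HasDerivAt.congr_deriv (f := fun r => r * h r ^ 2 * sFun a r ^ (p + 1)) d3 ?_
        simp only [hF', id, Pi.mul_apply, Pi.pow_apply]
        rw [hsW r hr, add_sub_cancel_right]
        have : p + 1 = N / 2 := by rw [hp]; ring
        rw [this]
        push_cast
        ring)
      ((intervalIntegrable_iff_integrableOn_Ioo_of_le hca'.le).2 (hint _ hF'c))
    rw [intervalIntegral.integral_of_le hca'.le, integral_Ioc_eq_integral_Ioo] at key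
    rw [key]
    have : sFun a a = 0 := by unfold sFun; field_simp; ring
    simp only [this, hbc]
    rw [Real.zero_rpow (by linarith)]
    ring
  have hpt : ∀ r ∈ Set.Ioo c a, (N / (2 * a ^ 2)) * (r ^ 2 * h r ^ 2 * W r)
      ≤ h r ^ 2 * W r + (2 * a ^ 2 / N) * (g r ^ 2 * sFun a r * W r) - F' r := by
    intro r hr
    have hs0 := (hsIoo r (hsub r hr)).le
    have hW0 : 0 ≤ W r := Real.rpow_nonneg hs0 _
    have e1 := hs1 r
    simp only [hF']
    set S := sFun a r
    set k : ℝ := N / (2 * a ^ 2) with hk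
    have hk0 : 0 < k := by positivity
    have k1 : (N : ℝ) / a ^ 2 = 2 * k := by rw [hk]; field_simp
    have k2 : 2 * a ^ 2 / (N : ℝ) = k⁻¹ := by rw [hk, inv_div]
    rw [k1, k2]
    have q : 2 * r * h r * g r * S ≤ k * (r ^ 2 * h r ^ 2) + k⁻¹ * (g r ^ 2 * S) := by
      have t1 : 0 ≤ k⁻¹ * (k * (r * h r) - g r * S) ^ 2 := by positivity
      have t2 : k⁻¹ * (k * (r * h r) - g r * S) ^ 2 =
        k * (r ^ 2 * h r ^ 2) - 2 * r * h r * g r * S + k⁻¹ * (g r ^ 2 * S) * S := by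
        field_simp
        ring
      have t3 : k⁻¹ * (g r ^ 2 * S) * S ≤ k⁻¹ * (g r ^ 2 * S) :=
        mul_le_of_le_one_right (by positivity) e1
      linarith
    have q2 : h r ^ 2 * S ≤ h r ^ 2 := mul_le_of_le_one_right (by positivity) e1
    have q3 := mul_le_mul_of_nonneg_right (add_le_add q q2) hW0
    nlinarith [q3]
  have hI := setIntegral_mono_on ((hint _ hM).const_mul (N / (2 * a ^ 2)))
    (((hint _ hA).add ((hint _ hB).const_mul (2 * a ^ 2 / N))).sub (hint _ hF'c))
    measurableSet_Ioo hpt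
  have hR : ∫ r in Set.Ioo c a, (h r ^ 2 * W r + (2 * a ^ 2 / N) * (g r ^ 2 * sFun a r * W r)
      - F' r) = (∫ r in Set.Ioo c a, h r ^ 2 * W r)
        + (2 * a ^ 2 / N) * ∫ r in Set.Ioo c a, g r ^ 2 * sFun a r * W r := by
    have hAB : IntegrableOn (fun r => h r ^ 2 * W r
        + (2 * a ^ 2 / N) * (g r ^ 2 * sFun a r * W r)) (Set.Ioo c a) :=
      (hint _ hA).add ((hint _ hB).const_mul (2 * a ^ 2 / N))
    rw [integral_sub hAB (hint _ hF'c),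
      integral_add (hint _ hA) ((hint _ hB).const_mul (2 * a ^ 2 / N)), hFz,
      integral_const_mul, sub_zero]
  have hI' := hI.trans_eq hR
  rw [integral_const_mul] at hI'
  have E1 : ∫ r in Set.Ioo c a, h r ^ 2 * wFun N a r
      = (∫ r in Set.Ioo c a, h r ^ 2 * W r) * Z⁻¹ := by
    rw [← integral_mul_const]
    exact setIntegral_congr_fun measurableSet_Ioo
      (fun r hr => by simp only [hw r hr]; ring)
  have E2 : ∫ r in Set.Ioo c a, (deriv h r) ^ 2 * sFun a r * wFun N a r
      = (∫ r in Set.Ioo c a, g r ^ 2 * sFun a r * W r) * Z⁻¹ := by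
    rw [← integral_mul_const]
    exact setIntegral_congr_fun measurableSet_Ioo
      (fun r hr => by simp only [hw r hr, (hgd r hr).deriv]; ring)
  have E3 : ∫ r in Set.Ioo c a, r ^ 2 * h r ^ 2 * wFun N a r
      = (∫ r in Set.Ioo c a, r ^ 2 * h r ^ 2 * W r) * Z⁻¹ := by
    rw [← integral_mul_const]
    exact setIntegral_congr_fun measurableSet_Ioo
      (fun r hr => by simp only [hw r hr]; ring)
  rw [E1] at hnorm
  rw [E2] at hlam
  rw [E3]
  have hfin := mul_le_mul_of_nonneg_right hI' (inv_nonneg.2 hZ0)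
  rw [add_mul, hnorm, mul_assoc, mul_assoc, ← hlam] at hfin
  have hfin2 := mul_le_mul_of_nonneg_left hfin (by positivity : 0 ≤ 2 * a ^ 2 / (N:ℝ))
  calc _ = 2 * a ^ 2 / (N:ℝ) * (N / (2 * a ^ 2) *
        ((∫ r in Set.Ioo c a, r ^ 2 * h r ^ 2 * W r) * Z⁻¹)) := by
          field_simp
    _ ≤ _ := hfin2
    _ = _ := by ring
end

section
/- Fix α > 0 and R ∈ ℝ. Let {a_N}_{N ≥ 2} be positive reals and {θ_N}_{N ≥ 2} ⊂ (0,π) satisfy: a_N/√(N−1) → α, a_N cos θ_N → αR, sup_N (a_N² − α²(N−2))/a_N < ∞, and a_N cos θ_N ≥ αR for all N. Set c_N := a_N cos θ_N. For each N let λ_N > 0 and let h_N : [c_N, a_N] → ℝ be continuous on [c_N, a_N], twice continuously differentiable on (c_N, a_N], positive on (c_N, a_N], with h_N(c_N) = 0, satisfying s_{N,a_N}(r) h_N''(r) − (N r / a_N²) h_N'(r) = −λ_N h_N(r) on (c_N, a_N) and normalized so that ∫_{c_N}^{a_N} h_N(r)² w_{N,a_N}(r) dr = 1; assume moreover sup_N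 λ_N < ∞. Then the sequence {λ_N}_N converges to a limit λ_∞ > 0, there exists h_∞ : [αR, ∞) → ℝ, continuous on [αR, ∞), twice continuously differentiable and positive on (αR, ∞), with h_∞(αR) = 0, satisfying h_∞''(r) − (r/α²) h_∞'(r) = −λ_∞ h_∞(r) on (αR, ∞) and ∫_{αR}^∞ h_∞(r)² dγ¹_α(r) = 1; and the functions r ↦ h_N(r) s_{N,a_N}(r) √(w_{N,a_N}(r)/w_∞(r)) · 1_{(c_N,a_N)}(r) converge to h_∞ strongly in L²((αR,∞), γ¹_α) as N → ∞. -/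
open Filter MeasureTheory

theorem aa_lite (f : ℕ → ℝ → ℝ) (x0 : ℝ) (hf0 : ∀ n, f n x0 = 0)
    (hL : ∀ T : ℝ, ∃ L : ℝ, ∀ᶠ n in atTop, ∀ x ≤ T, ∀ y ≤ T, |f n x - f n y| ≤ L * |x - y|) :
    ∃ φ : ℕ → ℕ, StrictMono φ ∧ ∃ F : ℝ → ℝ, Continuous F ∧
      ∀ x, Tendsto (fun n => f (φ n) x) atTop (nhds (F x)) := by
  have hB : ∀ q : ℚ, ∃ B : ℝ, ∀ n, |f n q| ≤ B := by
    intro q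
    obtain ⟨L, h⟩ := hL (max (q : ℝ) x0)
    have : IsBoundedUnder (fun x1 x2 => x1 ≤ x2) atTop (fun n => |f n q|) := by
      refine ⟨L * |(q : ℝ) - x0|, ?_⟩
      rw [eventually_map]
      filter_upwards [h] with n hn
      have := hn q (le_max_left _ _) x0 (le_max_right _ _)
      rwa [hf0, sub_zero] at this
    obtain ⟨B, hB⟩ := this.bddAbove_range
    exact ⟨B, fun n => hB ⟨n, rfl⟩⟩
  choose B hB using hB
  have hK : IsCompact (Set.univ.pi (fun q : ℚ => Set.Icc (-B q) (B q))) :=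
    isCompact_univ_pi (fun q => isCompact_Icc)
  obtain ⟨A, -, φ, hφ, hA⟩ := hK.tendsto_subseq (x := fun n => fun q : ℚ => f n q)
    (fun n q _ => abs_le.mp (hB q n))
  rw [tendsto_pi_nhds] at hA
  have hL' : ∀ T : ℝ, ∃ L : ℝ, 0 < L ∧
      ∀ᶠ n in atTop, ∀ x ≤ T, ∀ y ≤ T, |f (φ n) x - f (φ n) y| ≤ L * |x - y| := by
    intro T
    obtain ⟨L, h⟩ := hL T
    refine ⟨|L| + 1, by positivity, ?_⟩
    filter_upwards [hφ.tendsto_atTop.eventually h] with n hn x hx y hy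
    refine (hn x hx y hy).trans ?_
    gcongr
    linarith [le_abs_self L]
  have hC : ∀ x, CauchySeq (fun n => f (φ n) x) := by
    intro x
    obtain ⟨L, hLp, h⟩ := hL' (x + 1)
    rw [Metric.cauchySeq_iff]
    intro ε hε
    have hδ : 0 < min 1 (ε / (4 * L)) := by positivity
    obtain ⟨q, hq1, hq2⟩ := exists_rat_btwn (show x < x + min 1 (ε / (4 * L)) by linarith)
    have hc := (hA q).cauchySeq
    rw [Metric.cauchySeq_iff] at hc
    obtain ⟨N1, hN1⟩ := hc (ε / 4) (by positivity)
    obtain ⟨N2, hN2⟩ := eventually_atTop.mp h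
    have hqx : (q : ℝ) ≤ x + 1 := by linarith [min_le_left 1 (ε / (4 * L))]
    have hk : L * |x - q| ≤ ε / 4 := by
      have : |x - q| ≤ ε / (4 * L) := by
        rw [abs_sub_comm, abs_of_pos (by linarith)]
        linarith [min_le_right 1 (ε / (4 * L))]
      calc L * |x - q| ≤ L * (ε / (4 * L)) := by gcongr
        _ = ε / 4 := by field_simp
    refine ⟨max N1 N2, fun m hm n hn => ?_⟩
    have h1 := hN1 m (le_of_max_le_left hm) n (le_of_max_le_left hn)
    have h2 := hN2 m (le_of_max_le_right hm) x (by linarith) q hqx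
    have h3 := hN2 n (le_of_max_le_right hn) x (by linarith) q hqx
    simp only [Real.dist_eq, Function.comp] at h1 ⊢
    have e1 := abs_le.mp (h2.trans hk)
    have e2 := abs_le.mp (h3.trans hk)
    have e3 := abs_lt.mp h1
    rw [abs_lt]
    constructor <;> linarith [e1.1, e1.2, e2.1, e2.2, e3.1, e3.2]
  choose F hF using fun x => cauchySeq_tendsto_of_complete (hC x)
  refine ⟨φ, hφ, F, ?_, hF⟩
  rw [continuous_iff_continuousAt]
  intro x
  obtain ⟨L, hLp, h⟩ := hL' (x + 1)
  have hlip : ∀ y ≤ x + 1, |F y - F x| ≤ L * |y - x| := by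
    intro y hy
    refine le_of_tendsto (((hF y).sub (hF x)).abs) ?_
    filter_upwards [h] with n hn using hn y hy x (by linarith)
  rw [ContinuousAt, tendsto_iff_dist_tendsto_zero]
  refine squeeze_zero' (g := fun y => L * |y - x|) (Eventually.of_forall fun _ => dist_nonneg) ?_ ?_
  · filter_upwards [Iio_mem_nhds (show x < x + 1 by linarith)] with y hy
    exact hlip y (le_of_lt hy)
  · have : Continuous (fun y : ℝ => L * |y - x|) := by fun_prop
    simpa using this.tendsto x

theorem int_ind (k : ℝ → ℝ) {c0 c a T : ℝ} (h0 : c0 ≤ c) (hT : c ≤ T) (ha : T < a) :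
    ∫ r in c0..T, (Set.Ioo c a).indicator k r = ∫ r in c..T, k r := by
  rw [intervalIntegral.integral_of_le (h0.trans hT), intervalIntegral.integral_of_le hT,
    setIntegral_indicator measurableSet_Ioo]
  congr 2
  ext x
  simp only [Set.mem_inter_iff, Set.mem_Ioc, Set.mem_Ioo]
  constructor
  · rintro ⟨⟨_, h1⟩, h2, _⟩; exact ⟨h2, h1⟩
  · rintro ⟨h1, h2⟩; exact ⟨⟨by linarith, h2⟩, h1, by linarith⟩

theorem dct {c a : ℕ → ℝ} {c0 T : ℝ} (k : ℕ → ℝ → ℝ) (K : ℝ → ℝ) (hT : c0 < T)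
    (hc0 : ∀ n, c0 ≤ c n) (hc : Tendsto c atTop (nhds c0)) (ha : Tendsto a atTop atTop)
    (hk : ∀ n, ContinuousOn (k n) (Set.Ioo (c n) (a n)))
    (hb : ∃ M : ℝ, ∀ᶠ n in atTop, ∀ r ∈ Set.Ioo (c n) (a n), r ≤ T → |k n r| ≤ M)
    (hlim : ∀ r, c0 < r → Tendsto (fun n => k n r) atTop (nhds (K r))) :
    Tendsto (fun n => ∫ r in (c n)..T, k n r) atTop (nhds (∫ r in c0..T, K r)) := by
  obtain ⟨M, hM⟩ := hb
  have key : Tendsto (fun n => ∫ r in c0..T, (Set.Ioo (c n) (a n)).indicator (k n) r) atTop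
      (nhds (∫ r in c0..T, K r)) := by
    refine intervalIntegral.tendsto_integral_filter_of_dominated_convergence (fun _ => |M|) ?_ ?_ ?_ ?_
    · refine Eventually.of_forall fun n => AEStronglyMeasurable.restrict ?_
      rw [aestronglyMeasurable_indicator_iff measurableSet_Ioo]
      exact (hk n).aestronglyMeasurable measurableSet_Ioo
    · filter_upwards [hM] with n hn
      refine Eventually.of_forall fun r hr => ?_
      rw [Set.uIoc_of_le hT.le] at hr
      by_cases h : r ∈ Set.Ioo (c n) (a n)
      · rw [Set.indicator_of_mem h]
        exact (hn r h hr.2).trans (le_abs_self M)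
      · rw [Set.indicator_of_notMem h]; simp
    · exact intervalIntegrable_const
    · refine Eventually.of_forall fun r hr => ?_
      rw [Set.uIoc_of_le hT.le] at hr
      refine (hlim r hr.1).congr' ?_
      filter_upwards [hc.eventually (gt_mem_nhds hr.1), ha.eventually_gt_atTop r] with n h1 h2
      rw [Set.indicator_of_mem (show r ∈ Set.Ioo (c n) (a n) from ⟨h1, h2⟩)]
  refine key.congr' ?_
  filter_upwards [hc.eventually (gt_mem_nhds hT), ha.eventually_gt_atTop T] with n h1 h2
  exact int_ind (k n) (hc0 n) (le_of_lt h1) h2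

/-- data of a single prelimit problem -/
structure Pre (L C c a lam : ℝ) (h g s Q : ℝ → ℝ) : Prop where
  hca : c < a
  lam_pos : 0 < lam
  lam_le : lam ≤ L
  hc : ContinuousOn h (Set.Icc c a)
  gc : ContinuousOn g (Set.Icc c a)
  sc : ContinuousOn s (Set.Icc c a)
  Qc : ContinuousOn Q (Set.Icc c a)
  hd : ∀ r ∈ Set.Ioo c a, HasDerivAt h (g r / (s r * Q r)) r
  gd : ∀ r ∈ Set.Ioo c a, HasDerivAt g (-lam * (Q r * h r)) r
  spos : ∀ r ∈ Set.Ico c a, 0 < s r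
  Qpos : ∀ r ∈ Set.Ico c a, 0 < Q r
  sle : ∀ r ∈ Set.Icc c a, s r ≤ 1
  hnn : ∀ r ∈ Set.Icc c a, 0 ≤ h r
  gnn : ∀ r ∈ Set.Icc c a, 0 ≤ g r
  hc0 : h c = 0
  gle : ∀ r ∈ Set.Icc c a, g r ≤ L
  norm : ∫ r in c..a, h r ^ 2 * Q r = 1
  tail : ∀ T, 0 < T → c ≤ T → T ≤ a → ∫ r in T..a, h r ^ 2 * Q r ≤ C / T ^ 2
  energy : ∀ T, c ≤ T → T < a → ∫ r in c..T, g r ^ 2 / (s r * Q r) ≤ L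

theorem Pre.h_int {L C c a lam : ℝ} {h g s Q : ℝ → ℝ} (P : Pre L C c a lam h g s Q)
    {x y : ℝ} (hx : c ≤ x) (hxy : x ≤ y) (hy : y < a) :
    ∫ r in x..y, g r / (s r * Q r) = h y - h x := by
  have hsub : Set.Icc x y ⊆ Set.Icc c a := Set.Icc_subset_Icc hx hy.le
  refine intervalIntegral.integral_eq_sub_of_hasDerivAt_of_le hxy (P.hc.mono hsub)
    (fun r hr => P.hd r ⟨by linarith [hr.1], by linarith [hr.2]⟩) ?_
  refine ContinuousOn.intervalIntegrable_of_Icc hxy ?_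
  refine (P.gc.mono hsub).div ((P.sc.mono hsub).mul (P.Qc.mono hsub)) fun r hr => ?_
  have hm : r ∈ Set.Ico c a := ⟨by linarith [hr.1], by linarith [hr.2]⟩
  exact (mul_pos (P.spos r hm) (P.Qpos r hm)).ne'

theorem Pre.g_int {L C c a lam : ℝ} {h g s Q : ℝ → ℝ} (P : Pre L C c a lam h g s Q)
    {y : ℝ} (hxy : c ≤ y) (hy : y ≤ a) :
    g y = g c - lam * ∫ r in c..y, Q r * h r := by
  have hsub : Set.Icc c y ⊆ Set.Icc c a := Set.Icc_subset_Icc le_rfl hy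
  have := intervalIntegral.integral_eq_sub_of_hasDerivAt_of_le hxy (P.gc.mono hsub)
    (fun r hr => P.gd r ⟨by linarith [hr.1], by linarith [hr.2]⟩)
    (ContinuousOn.intervalIntegrable_of_Icc hxy
      (continuousOn_const.mul ((P.Qc.mono hsub).mul (P.hc.mono hsub))))
  rw [intervalIntegral.integral_const_mul] at this
  linarith

theorem Pre.lip {L C c a lam : ℝ} {h g s Q : ℝ → ℝ} (P : Pre L C c a lam h g s Q)
    {T m : ℝ} (hT : T < a) (hm : 0 < m) (hb : ∀ r ∈ Set.Icc c T, m ≤ s r * Q r) :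
    ∀ x ∈ Set.Icc c T, ∀ y ∈ Set.Icc c T, |h x - h y| ≤ L / m * |x - y| := by
  have key : ∀ x ∈ Set.Icc c T, ∀ y ∈ Set.Icc c T, x ≤ y → |h y - h x| ≤ L / m * |y - x| := by
    intro x hx y hy hxy
    rw [← P.h_int hx.1 hxy (by linarith [hy.2]), ← Real.norm_eq_abs]
    refine intervalIntegral.norm_integral_le_of_norm_le_const fun r hr => ?_
    rw [Set.uIoc_of_le hxy] at hr
    have hr' : r ∈ Set.Icc c T := ⟨by linarith [hx.1, hr.1], by linarith [hy.2, hr.2]⟩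
    have hr2 : r ∈ Set.Icc c a := ⟨hr'.1, by linarith [hr'.2]⟩
    have h1 := hb r hr'
    rw [Real.norm_eq_abs, abs_of_nonneg (div_nonneg (P.gnn r hr2) (by linarith))]
    exact div_le_div₀ (by linarith [P.lam_pos, P.lam_le]) (P.gle r hr2) hm h1
  intro x hx y hy
  rcases le_total x y with hxy | hxy
  · rw [abs_sub_comm (h x), abs_sub_comm x]
    exact key x hx y hy hxy
  · exact key y hy x hx hxy

/-- a sequence of prelimit problems -/
structure PSeq (L C c0 W : ℝ) (w : ℝ → ℝ) (c a lam : ℕ → ℝ) (h g s Q : ℕ → ℝ → ℝ) : Prop where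
  pre : ∀ n, Pre L C (c n) (a n) (lam n) (h n) (g n) (s n) (Q n)
  c0le : ∀ n, c0 ≤ c n
  clim : Tendsto c atTop (nhds c0)
  alim : Tendsto a atTop atTop
  wc : Continuous w
  wpos : ∀ r, 0 < w r
  wle : ∀ r, w r ≤ W
  loc : ∀ T : ℝ, ∃ m > 0, ∃ M : ℝ, ∀ᶠ n in atTop, ∀ r ∈ Set.Icc (c n) T,
    m ≤ s n r * Q n r ∧ Q n r ≤ M
  slim : ∀ r, Tendsto (fun n => s n r) atTop (nhds 1)
  Qlim : ∀ r, Tendsto (fun n => Q n r) atTop (nhds (w r))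

theorem PSeq.comp {L C c0 W : ℝ} {w : ℝ → ℝ} {c a lam : ℕ → ℝ} {h g s Q : ℕ → ℝ → ℝ}
    (S : PSeq L C c0 W w c a lam h g s Q) {φ : ℕ → ℕ} (hφ : StrictMono φ) :
    PSeq L C c0 W w (fun n => c (φ n)) (fun n => a (φ n)) (fun n => lam (φ n))
      (fun n => h (φ n)) (fun n => g (φ n)) (fun n => s (φ n)) (fun n => Q (φ n)) where
  pre n := S.pre _
  c0le n := S.c0le _
  clim := S.clim.comp hφ.tendsto_atTop
  alim := S.alim.comp hφ.tendsto_atTop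
  wc := S.wc
  wpos := S.wpos
  wle := S.wle
  loc T := by
    obtain ⟨m, hm, M, h⟩ := S.loc T
    exact ⟨m, hm, M, hφ.tendsto_atTop.eventually h⟩
  slim r := (S.slim r).comp hφ.tendsto_atTop
  Qlim r := (S.Qlim r).comp hφ.tendsto_atTop

/-- limit eigenpairs -/
structure IsLim (c0 lam : ℝ) (w F G : ℝ → ℝ) : Prop where
  lam_pos : 0 < lam
  Fc : Continuous F
  Gc : Continuous G
  F0 : F c0 = 0
  Fpos : ∀ r, c0 < r → 0 < F r
  Gnn : ∀ r, c0 ≤ r → 0 ≤ G r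
  Fd : ∀ r, c0 < r → HasDerivAt F (G r / w r) r
  Gd : ∀ r, c0 < r → HasDerivAt G (-lam * (w r * F r)) r
  en : ∃ K : ℝ, ∀ T, c0 < T → ∫ r in c0..T, G r ^ 2 / w r ≤ K
  norm : ∫ r in Set.Ioi c0, F r ^ 2 * w r = 1

theorem PSeq.limit {L C c0 W : ℝ} {w : ℝ → ℝ} {c a lam : ℕ → ℝ} {h g s Q : ℕ → ℝ → ℝ}
    (S : PSeq L C c0 W w c a lam h g s Q) {lam0 κ : ℝ} {F : ℝ → ℝ}
    (hlam : Tendsto lam atTop (nhds lam0))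
    (hκ : Tendsto (fun n => g n (c n)) atTop (nhds κ))
    (hFc : Continuous F) (hF0 : F c0 = 0)
    (hh : ∀ r, c0 < r → Tendsto (fun n => h n r) atTop (nhds (F r))) :
    (∃ G, IsLim c0 lam0 w F G) ∧ 
    (∀ T, c0 < T → Tendsto (fun n => ∫ r in (c n)..T, h n r * s n r * √(Q n r / w r) * F r * w r)
      atTop (nhds (∫ r in c0..T, F r ^ 2 * w r))) := by
  have hL : 0 ≤ L := ((S.pre 0).lam_pos.le.trans (S.pre 0).lam_le)
  have hsub : ∀ n, Set.Ioo (c n) (a n) ⊆ Set.Icc (c n) (a n) := fun n => Set.Ioo_subset_Icc_self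
  have hmem : ∀ r, c0 < r → ∀ᶠ n in atTop, r ∈ Set.Ioo (c n) (a n) := by
    intro r hr
    filter_upwards [S.clim.eventually (gt_mem_nhds hr), S.alim.eventually_gt_atTop r] with n h1 h2
    exact ⟨h1, h2⟩
  -- local bounds
  have hbd : ∀ T, c0 < T → ∃ m > 0, ∃ M B : ℝ, 0 ≤ B ∧ 0 ≤ M ∧
      ∀ᶠ n in atTop, ∀ r ∈ Set.Ioo (c n) (a n), r ≤ T →
      m ≤ s n r * Q n r ∧ 0 ≤ Q n r ∧ Q n r ≤ M ∧ 0 ≤ h n r ∧ h n r ≤ B ∧ 0 ≤ g n r ∧ g n r ≤ L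
        ∧ 0 < s n r ∧ s n r ≤ 1 := by
    intro T hT
    obtain ⟨m, hm, M, hM⟩ := S.loc T
    refine ⟨m, hm, |M|, L / m * (T - c0), mul_nonneg (by positivity) (by linarith),
      abs_nonneg _, ?_⟩
    filter_upwards [hM, S.alim.eventually_gt_atTop T] with n h1 h2 r hr hrT
    have P := S.pre n
    have hr2 := hsub n hr
    have h3 := h1 r ⟨hr2.1, hrT⟩
    refine ⟨h3.1, (P.Qpos r ⟨hr2.1, hr.2⟩).le, h3.2.trans (le_abs_self _), P.hnn r hr2, ?_,
      P.gnn r hr2, P.gle r hr2, P.spos r ⟨hr2.1, hr.2⟩, P.sle r hr2⟩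
    have h4 := P.lip h2 hm (fun r hr => (h1 r hr).1) r ⟨hr2.1, hrT⟩ (c n) ⟨le_rfl, hr2.1.trans hrT⟩
    rw [P.hc0, sub_zero] at h4
    refine (le_abs_self _).trans (h4.trans ?_)
    have h5 := S.c0le n
    gcongr
    rw [abs_of_nonneg (by linarith [hr.1])]
    linarith
  have hcQh : ∀ n, ContinuousOn (fun r => s n r * Q n r) (Set.Ioo (c n) (a n)) := fun n =>
    ((S.pre n).sc.mul (S.pre n).Qc).mono (hsub n)
  have hsQ0 : ∀ n, ∀ r ∈ Set.Ioo (c n) (a n), s n r * Q n r ≠ 0 := fun n r hr =>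
    (mul_pos ((S.pre n).spos r ⟨hr.1.le, hr.2⟩) ((S.pre n).Qpos r ⟨hr.1.le, hr.2⟩)).ne'
  have hsQlim : ∀ r, Tendsto (fun n => s n r * Q n r) atTop (nhds (w r)) := fun r => by
    simpa using (S.slim r).mul (S.Qlim r)
  have hlam0 : 0 ≤ lam0 := ge_of_tendsto' hlam fun n => (S.pre n).lam_pos.le
  have hFnn : ∀ r, c0 ≤ r → 0 ≤ F r := by
    intro r hr
    rcases hr.eq_or_lt with rfl | hr
    · exact hF0.ge
    refine ge_of_tendsto (hh r hr) ?_
    filter_upwards [hmem r hr] with n hn using (S.pre n).hnn r (hsub n hn)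
  -- flux
  set G : ℝ → ℝ := fun r => κ - lam0 * ∫ x in c0..r, w x * F x with hG
  have hwF : Continuous fun x => w x * F x := S.wc.mul hFc
  have hGc : Continuous G :=
    continuous_const.sub (continuous_const.mul
      (intervalIntegral.continuous_primitive (fun a b => hwF.intervalIntegrable a b) c0))
  have hGd : ∀ r, HasDerivAt G (-lam0 * (w r * F r)) r := by
    intro r
    have := ((hwF.integral_hasStrictDerivAt c0 r).hasDerivAt.const_mul lam0).const_sub κ
    rw [neg_mul]; exact this
  have hglim : ∀ r, c0 < r → Tendsto (fun n => g n r) atTop (nhds (G r)) := by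
    intro r hr
    have h1 : Tendsto (fun n => ∫ x in (c n)..r, Q n x * h n x) atTop
        (nhds (∫ x in c0..r, w x * F x)) := by
      refine dct _ _ hr S.c0le S.clim S.alim (fun n => ((S.pre n).Qc.mul (S.pre n).hc).mono (hsub n))
        ?_ (fun x hx => (S.Qlim x).mul (hh x hx))
      obtain ⟨m, hm, M, B, hB, hM0, hM⟩ := hbd r hr
      refine ⟨M * B, ?_⟩
      filter_upwards [hM] with n hn x hx hxr
      obtain ⟨h1, h2, h3, h4, h5, -⟩ := hn x hx hxr
      rw [abs_of_nonneg (by positivity)]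
      gcongr
    refine (hκ.sub (hlam.mul h1)).congr' ?_
    filter_upwards [hmem r hr] with n hn
    exact ((S.pre n).g_int hn.1.le hn.2.le).symm
  have hGnn : ∀ r, c0 ≤ r → 0 ≤ G r := by
    intro r hr
    rcases hr.eq_or_lt with rfl | hr
    · simp only [hG, intervalIntegral.integral_same, mul_zero, sub_zero]
      exact ge_of_tendsto' hκ fun n => (S.pre n).gnn _ ⟨le_rfl, (S.pre n).hca.le⟩
    refine ge_of_tendsto (hglim r hr) ?_
    filter_upwards [hmem r hr] with n hn using (S.pre n).gnn r (hsub n hn)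
  have hGw : Continuous fun x => G x / w x := hGc.div S.wc fun x => (S.wpos x).ne'
  have hFint : ∀ r, c0 < r → F r = ∫ x in c0..r, G x / w x := by
    intro r hr
    have h1 : Tendsto (fun n => ∫ x in (c n)..r, g n x / (s n x * Q n x)) atTop
        (nhds (∫ x in c0..r, G x / w x)) := by
      refine dct _ _ hr S.c0le S.clim S.alim
        (fun n => ((S.pre n).gc.mono (hsub n)).div (hcQh n) (hsQ0 n))
        ?_ (fun x hx => (hglim x hx).div (hsQlim x) (S.wpos x).ne')
      obtain ⟨m, hm, M, B, hB, hM0, hM⟩ := hbd r hr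
      refine ⟨L / m, ?_⟩
      filter_upwards [hM] with n hn x hx hxr
      obtain ⟨h1, h2, h3, h4, h5, h6, h7, -⟩ := hn x hx hxr
      rw [abs_of_nonneg (div_nonneg h6 (by linarith))]
      exact div_le_div₀ hL h7 hm h1
    refine tendsto_nhds_unique (hh r hr) (h1.congr' ?_)
    filter_upwards [hmem r hr] with n hn
    rw [(S.pre n).h_int le_rfl hn.1.le hn.2, (S.pre n).hc0, sub_zero]
  have hFd : ∀ r, c0 < r → HasDerivAt F (G r / w r) r := by
    intro r hr
    refine (hGw.integral_hasStrictDerivAt c0 r).hasDerivAt.congr_of_eventuallyEq ?_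
    filter_upwards [Ioi_mem_nhds hr] with x hx using hFint x hx
  have hen : ∀ T, c0 < T → ∫ r in c0..T, G r ^ 2 / w r ≤ L := by
    intro r hr
    have h1 : Tendsto (fun n => ∫ x in (c n)..r, g n x ^ 2 / (s n x * Q n x)) atTop
        (nhds (∫ x in c0..r, G x ^ 2 / w x)) := by
      refine dct _ _ hr S.c0le S.clim S.alim
        (fun n => (((S.pre n).gc.mono (hsub n)).pow 2).div (hcQh n) (hsQ0 n))
        ?_ (fun x hx => ((hglim x hx).pow 2).div (hsQlim x) (S.wpos x).ne')
      obtain ⟨m, hm, M, B, hB, hM0, hM⟩ := hbd r hr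
      refine ⟨L ^ 2 / m, ?_⟩
      filter_upwards [hM] with n hn x hx hxr
      obtain ⟨h1, h2, h3, h4, h5, h6, h7, -⟩ := hn x hx hxr
      rw [abs_of_nonneg (div_nonneg (sq_nonneg _) (by linarith))]
      refine div_le_div₀ (by positivity) (by gcongr) hm h1
    refine le_of_tendsto h1 ?_
    filter_upwards [hmem r hr] with n hn using (S.pre n).energy r hn.1.le hn.2
  -- mass
  have hmass : ∀ T, c0 < T → Tendsto (fun n => ∫ x in (c n)..T, h n x ^ 2 * Q n x) atTop
        (nhds (∫ x in c0..T, F x ^ 2 * w x)) := by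
    intro r hr
    refine dct _ _ hr S.c0le S.clim S.alim
        (fun n => (((S.pre n).hc.pow 2).mul (S.pre n).Qc).mono (hsub n))
        ?_ (fun x hx => ((hh x hx).pow 2).mul (S.Qlim x))
    obtain ⟨m, hm, M, B, hB, hM0, hM⟩ := hbd r hr
    refine ⟨B ^ 2 * M, ?_⟩
    filter_upwards [hM] with n hn x hx hxr
    obtain ⟨h1, h2, h3, h4, h5, h6, h7, -⟩ := hn x hx hxr
    rw [abs_of_nonneg (by positivity)]
    gcongr
  have hsplit : ∀ n, ∀ T ∈ Set.Ioo (c n) (a n), (∫ x in (c n)..T, h n x ^ 2 * Q n x)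
      = 1 - ∫ x in T..(a n), h n x ^ 2 * Q n x := by
    intro n T hT
    have P := S.pre n
    have hcc : ContinuousOn (fun x => h n x ^ 2 * Q n x) (Set.Icc (c n) (a n)) :=
      (P.hc.pow 2).mul P.Qc
    rw [← P.norm, eq_sub_iff_add_eq]
    refine intervalIntegral.integral_add_adjacent_intervals
      (ContinuousOn.intervalIntegrable_of_Icc hT.1.le (hcc.mono (Set.Icc_subset_Icc le_rfl hT.2.le)))
      (ContinuousOn.intervalIntegrable_of_Icc hT.2.le (hcc.mono (Set.Icc_subset_Icc hT.1.le le_rfl)))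
  have hup : ∀ T, c0 < T → ∫ x in c0..T, F x ^ 2 * w x ≤ 1 := by
    intro T hT
    refine le_of_tendsto (hmass T hT) ?_
    filter_upwards [hmem T hT] with n hn
    rw [hsplit n T hn]
    have : 0 ≤ ∫ x in T..(a n), h n x ^ 2 * Q n x := by
      rw [intervalIntegral.integral_of_le hn.2.le, integral_Ioc_eq_integral_Ioo]
      refine setIntegral_nonneg measurableSet_Ioo fun x hx => ?_
      have := ((S.pre n).Qpos x ⟨by linarith [hx.1, hn.1], hx.2⟩)
      positivity
    linarith
  have hlow : ∀ T, c0 < T → 0 < T → 1 - C / T ^ 2 ≤ ∫ x in c0..T, F x ^ 2 * w x := by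
    intro T hT hT0
    refine ge_of_tendsto (hmass T hT) ?_
    filter_upwards [hmem T hT] with n hn
    rw [hsplit n T hn]
    have := (S.pre n).tail T hT0 hn.1.le hn.2.le
    linarith
  have hF2c : Continuous fun x => F x ^ 2 * w x := (hFc.pow 2).mul S.wc
  have hFi : IntegrableOn (fun x => F x ^ 2 * w x) (Set.Ioi c0) := by
    refine integrableOn_Ioi_of_intervalIntegral_norm_bounded (l := atTop) (b := fun T : ℝ => T) 1 c0
      (fun T => hF2c.integrableOn_Ioc) tendsto_id ?_
    filter_upwards [eventually_gt_atTop c0] with T hT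
    have : ∀ x, ‖F x ^ 2 * w x‖ = F x ^ 2 * w x := fun x => by
      rw [Real.norm_eq_abs, abs_of_nonneg (mul_nonneg (sq_nonneg _) (S.wpos x).le)]
    simp only [this]
    exact hup T hT
  have hnorm : ∫ x in Set.Ioi c0, F x ^ 2 * w x = 1 := by
    have h1 := intervalIntegral_tendsto_integral_Ioi c0 hFi (tendsto_id (α := ℝ))
    refine tendsto_nhds_unique h1 ?_
    have h2 : Tendsto (fun T : ℝ => 1 - C / T ^ 2) atTop (nhds 1) := by
      simpa using tendsto_const_nhds.sub
        (tendsto_const_nhds.div_atTop (tendsto_pow_atTop (α := ℝ) (two_ne_zero)))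
    refine tendsto_of_tendsto_of_tendsto_of_le_of_le' h2 tendsto_const_nhds ?_ ?_
    · filter_upwards [eventually_gt_atTop c0, eventually_gt_atTop 0] with T h3 h4 using hlow T h3 h4
    · filter_upwards [eventually_gt_atTop c0] with T h3 using hup T h3
  have hGκ : G c0 = κ := by simp [hG]
  have hκ0 : 0 ≤ κ := hGκ ▸ hGnn c0 le_rfl
  have hκpos : 0 < κ := by
    refine lt_of_le_of_ne hκ0 fun hk => ?_
    have hGle : ∀ r, c0 ≤ r → G r ≤ 0 := by
      intro r hr
      simp only [hG, ← hk, zero_sub, neg_nonpos]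
      refine mul_nonneg hlam0 (intervalIntegral.integral_nonneg hr fun x hx => ?_)
      exact mul_nonneg (S.wpos x).le (hFnn x hx.1)
    have hF00 : ∀ r, c0 < r → F r = 0 := by
      intro r hr
      refine le_antisymm ?_ (hFnn r hr.le)
      rw [hFint r hr]
      have : 0 ≤ ∫ x in c0..r, -(G x / w x) :=
        intervalIntegral.integral_nonneg hr.le fun x hx => by
          rw [neg_nonneg]
          exact div_nonpos_of_nonpos_of_nonneg (hGle x hx.1) (S.wpos x).le
      rw [intervalIntegral.integral_neg] at this
      linarith
    have : ∫ x in Set.Ioi c0, F x ^ 2 * w x = 0 := by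
      refine setIntegral_eq_zero_of_forall_eq_zero fun x hx => ?_
      rw [hF00 x hx]; simp
    linarith
  have hFpos : ∀ r, c0 < r → 0 < F r := by
    intro r hr
    rw [hFint r hr]
    refine intervalIntegral.integral_pos hr hGw.continuousOn
      (fun x hx => div_nonneg (hGnn x hx.1.le) (S.wpos x).le) ⟨c0, ⟨le_rfl, hr.le⟩, ?_⟩
    rw [hGκ]; exact div_pos hκpos (S.wpos _)
  have hlampos : 0 < lam0 := by
    refine lt_of_le_of_ne hlam0 fun hk => ?_
    have hGκ' : ∀ r, G r = κ := fun r => by simp [hG, ← hk]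
    have hW : 0 < W := (S.wpos 0).trans_le (S.wle 0)
    have hd : 0 < κ ^ 2 / W := by positivity
    set T := c0 + (L + 1) / (κ ^ 2 / W) with hTdef
    have hT : c0 < T := by
      have : 0 < (L + 1) / (κ ^ 2 / W) := by positivity
      linarith
    have h1 := hen T hT
    have h2 : ∫ r in c0..T, κ ^ 2 / W ≤ ∫ r in c0..T, G r ^ 2 / w r := by
      refine intervalIntegral.integral_mono_on hT.le (by simp)
        (((hGc.pow 2).div S.wc fun x => (S.wpos x).ne').intervalIntegrable _ _) fun x hx => ?_
      rw [hGκ']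
      exact div_le_div_of_nonneg_left (by positivity) (S.wpos x) (S.wle x)
    rw [intervalIntegral.integral_const, smul_eq_mul] at h2
    have h3 : (T - c0) * (κ ^ 2 / W) = L + 1 := by
      rw [hTdef]; field_simp; ring
    linarith
  refine ⟨⟨G, hlampos, hFc, hGc, hF0, hFpos, hGnn, hFd, fun r _ => hGd r, ⟨L, hen⟩, hnorm⟩, ?_⟩
  intro T hT
  refine dct _ _ hT S.c0le S.clim S.alim (fun n => ?_) ?_ (fun x hx => ?_)
  · have P := S.pre n
    have h1 : ContinuousOn (fun r => Q n r / w r) (Set.Ioo (c n) (a n)) :=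
      (P.Qc.mono (hsub n)).div S.wc.continuousOn fun x _ => (S.wpos x).ne'
    exact ((((P.hc.mono (hsub n)).mul (P.sc.mono (hsub n))).mul h1.sqrt).mul hFc.continuousOn).mul
      S.wc.continuousOn
  · obtain ⟨m, hm, M, B, hB, hM0, hM⟩ := hbd T hT
    obtain ⟨BF, hBF⟩ := (isCompact_Icc (a := c0) (b := T)).exists_bound_of_continuousOn
      (f := fun x => √(M / w x) * F x * w x)
      (((((continuous_const.div S.wc fun x => (S.wpos x).ne').sqrt).mul hFc).mul S.wc).continuousOn)
    refine ⟨B * 1 * BF, ?_⟩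
    filter_upwards [hM] with n hn x hx hxr
    obtain ⟨h1, h2, h3, h4, h5, h6, h7, h8, h9⟩ := hn x hx hxr
    have hx0 : c0 ≤ x := (S.c0le n).trans hx.1.le
    have hb := hBF x ⟨hx0, hxr⟩
    have hFx := hFnn x hx0
    have hwx := S.wpos x
    rw [Real.norm_eq_abs, abs_of_nonneg (by positivity)] at hb
    rw [abs_of_nonneg (by positivity)]
    calc h n x * s n x * √(Q n x / w x) * F x * w x
        = (h n x * s n x) * (√(Q n x / w x) * F x * w x) := by ring
      _ ≤ (B * 1) * (√(M / w x) * F x * w x) := by gcongr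
      _ ≤ B * 1 * BF := by gcongr
  · have h1 : Tendsto (fun n => √(Q n x / w x)) atTop (nhds 1) := by
      have := ((S.Qlim x).div_const (w x)).sqrt
      rwa [div_self (S.wpos x).ne', Real.sqrt_one] at this
    have := ((((hh x hx).mul (S.slim x)).mul h1).mul_const (F x)).mul_const (w x)
    convert this using 2
    ring

theorem PSeq.l2 {L C c0 W : ℝ} {w : ℝ → ℝ} {c a lam : ℕ → ℝ} {h g s Q : ℕ → ℝ → ℝ}
    (S : PSeq L C c0 W w c a lam h g s Q) {lam0 : ℝ} {F G : ℝ → ℝ} (hF : IsLim c0 lam0 w F G)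
    (hcr : ∀ T, c0 < T → Tendsto
      (fun n => ∫ r in (c n)..T, h n r * s n r * √(Q n r / w r) * F r * w r)
      atTop (nhds (∫ r in c0..T, F r ^ 2 * w r))) :
    Tendsto (fun n => ∫ r in Set.Ioi c0,
      ((if r ∈ Set.Ioo (c n) (a n) then h n r * s n r * √(Q n r / w r) else 0) - F r) ^ 2 * w r)
      atTop (nhds 0) := by
  have hF2 : IntegrableOn (fun x => F x ^ 2 * w x) (Set.Ioi c0) := by
    by_contra hne
    have := integral_undef hne
    rw [hF.norm] at this
    norm_num at this
  have hwn : ∀ x, 0 ≤ w x := fun x => (S.wpos x).le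
  have hFnn : ∀ x, c0 < x → 0 ≤ F x := fun x hx => (hF.Fpos x hx).le
  set B : ℕ → ℝ → ℝ := fun n r =>
    if r ∈ Set.Ioo (c n) (a n) then h n r * s n r * √(Q n r / w r) else 0 with hB
  have hBind : ∀ n, B n = (Set.Ioo (c n) (a n)).indicator
      (fun r => h n r * s n r * √(Q n r / w r)) := by
    intro n; ext r; simp [hB, Set.indicator_apply]
  have hBnn : ∀ n r, 0 ≤ B n r := by
    intro n r
    simp only [hB]
    split_ifs with hr
    · have P := S.pre n
      have := P.hnn r ⟨hr.1.le, hr.2.le⟩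
      have := P.spos r ⟨hr.1.le, hr.2⟩
      positivity
    · exact le_rfl
  have hBm : ∀ n, AEStronglyMeasurable (B n) (volume.restrict (Set.Ioi c0)) := by
    intro n
    refine AEStronglyMeasurable.restrict ?_
    rw [hBind, aestronglyMeasurable_indicator_iff measurableSet_Ioo]
    refine ContinuousOn.aestronglyMeasurable ?_ measurableSet_Ioo
    have P := S.pre n
    have hsub : Set.Ioo (c n) (a n) ⊆ Set.Icc (c n) (a n) := Set.Ioo_subset_Icc_self
    have h1 : ContinuousOn (fun r => Q n r / w r) (Set.Ioo (c n) (a n)) :=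
      (P.Qc.mono hsub).div S.wc.continuousOn fun x _ => (S.wpos x).ne'
    exact ((P.hc.mono hsub).mul (P.sc.mono hsub)).mul h1.sqrt
  have hB2le : ∀ n r, B n r ^ 2 * w r
      ≤ (Set.Ioo (c n) (a n)).indicator (fun r => h n r ^ 2 * Q n r) r := by
    intro n r
    by_cases hr : r ∈ Set.Ioo (c n) (a n)
    · have P := S.pre n
      rw [Set.indicator_of_mem hr, hBind, Set.indicator_of_mem hr]
      have hq := P.Qpos r ⟨hr.1.le, hr.2⟩
      have h1 : √(Q n r / w r) ^ 2 * w r = Q n r := by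
        rw [Real.sq_sqrt (div_nonneg hq.le (hwn r)), div_mul_cancel₀ _ (S.wpos r).ne']
      have h2 : s n r ^ 2 ≤ 1 :=
        pow_le_one₀ (P.spos r ⟨hr.1.le, hr.2⟩).le (P.sle r ⟨hr.1.le, hr.2.le⟩)
      calc (h n r * s n r * √(Q n r / w r)) ^ 2 * w r
          = (h n r ^ 2 * Q n r) * s n r ^ 2 := by rw [mul_pow, mul_assoc, h1]; ring
        _ ≤ (h n r ^ 2 * Q n r) * 1 := by gcongr
        _ = _ := mul_one _
    · rw [Set.indicator_of_notMem hr, hBind, Set.indicator_of_notMem hr]; simp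
  have hIi : ∀ n, Integrable ((Set.Ioo (c n) (a n)).indicator (fun r => h n r ^ 2 * Q n r)) := by
    intro n
    rw [integrable_indicator_iff measurableSet_Ioo]
    have P := S.pre n
    exact (((P.hc.pow 2).mul P.Qc).integrableOn_Icc).mono_set Set.Ioo_subset_Icc_self
  have hB2i : ∀ n, IntegrableOn (fun r => B n r ^ 2 * w r) (Set.Ioi c0) := by
    intro n
    refine Integrable.mono' (hIi n).integrableOn
      (((hBm n).pow 2).mul S.wc.aestronglyMeasurable) (Eventually.of_forall fun r => ?_)
    rw [Real.norm_eq_abs, abs_of_nonneg (mul_nonneg (sq_nonneg _) (hwn r))]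
    exact hB2le n r
  have hB2 : ∀ n, ∫ r in Set.Ioi c0, B n r ^ 2 * w r ≤ 1 := by
    intro n
    have P := S.pre n
    calc ∫ r in Set.Ioi c0, B n r ^ 2 * w r
        ≤ ∫ r in Set.Ioi c0, (Set.Ioo (c n) (a n)).indicator (fun r => h n r ^ 2 * Q n r) r :=
          setIntegral_mono (hB2i n) (hIi n).integrableOn (hB2le n)
      _ = 1 := by
          rw [setIntegral_indicator measurableSet_Ioo, Set.inter_eq_self_of_subset_right
            (show Set.Ioo (c n) (a n) ⊆ Set.Ioi c0 from fun x hx => (S.c0le n).trans_lt hx.1), ← integral_Ioc_eq_integral_Ioo,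
            ← intervalIntegral.integral_of_le P.hca.le, P.norm]
  have hXi : ∀ n, IntegrableOn (fun r => B n r * F r * w r) (Set.Ioi c0) := by
    intro n
    refine Integrable.mono' ((hB2i n).add hF2)
      (((hBm n).mul hF.Fc.aestronglyMeasurable).mul S.wc.aestronglyMeasurable)
      (Eventually.of_forall fun r => ?_)
    simp only [Pi.add_apply]
    rw [Real.norm_eq_abs, abs_mul, abs_of_nonneg (hwn r), ← add_mul]
    refine mul_le_mul_of_nonneg_right ?_ (hwn r)
    rw [abs_le]
    constructor <;> nlinarith [sq_nonneg (B n r + F r), sq_nonneg (B n r - F r), sq_nonneg (B n r),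
      sq_nonneg (F r)]
  have hE : ∀ n, ∫ r in Set.Ioi c0, (B n r - F r) ^ 2 * w r
      ≤ 2 - 2 * ∫ r in Set.Ioi c0, B n r * F r * w r := by
    intro n
    have : ∀ r, (B n r - F r) ^ 2 * w r
        = (B n r ^ 2 * w r + F r ^ 2 * w r) - 2 * (B n r * F r * w r) := fun r => by ring
    simp only [this]
    have hsum : Integrable (fun r => B n r ^ 2 * w r + F r ^ 2 * w r)
      (volume.restrict (Set.Ioi c0)) := (hB2i n).add hF2
    rw [integral_sub hsum
      ((hXi n).const_mul 2), integral_add (hB2i n) hF2,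
      integral_const_mul, hF.norm]
    linarith [hB2 n]
  have hXT : ∀ T, c0 < T → ∀ᶠ n in atTop,
      ∫ r in (c n)..T, h n r * s n r * √(Q n r / w r) * F r * w r
        ≤ ∫ r in Set.Ioi c0, B n r * F r * w r := by
    intro T hT
    filter_upwards [S.clim.eventually (gt_mem_nhds hT), S.alim.eventually_gt_atTop T] with n h1 h2
    have h1' : c n < T := h1
    rw [intervalIntegral.integral_of_le h1'.le]
    have e : ∫ r in Set.Ioc (c n) T, h n r * s n r * √(Q n r / w r) * F r * w r
        = ∫ r in Set.Ioc (c n) T, B n r * F r * w r := by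
      refine setIntegral_congr_fun measurableSet_Ioc fun r hr => ?_
      have : r ∈ Set.Ioo (c n) (a n) := ⟨hr.1, hr.2.trans_lt h2⟩
      simp only [hB, if_pos this]
    rw [e]
    refine setIntegral_mono_set (hXi n) ?_ ?_
    · filter_upwards [ae_restrict_mem measurableSet_Ioi] with r hr
      exact mul_nonneg (mul_nonneg (hBnn n r) (hFnn r hr)) (hwn r)
    · exact Eventually.of_forall fun x hx => (S.c0le n).trans_lt hx.1
  have hlimT := intervalIntegral_tendsto_integral_Ioi c0 hF2 (tendsto_id (α := ℝ))
  rw [hF.norm] at hlimT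
  rw [Metric.tendsto_atTop']
  intro ε hε
  obtain ⟨T, hT1, hT2⟩ := ((hlimT.eventually (lt_mem_nhds (show 1 - ε / 4 < 1 by linarith))).and
    (eventually_gt_atTop c0)).exists
  have hev := (hcr T hT2).eventually (lt_mem_nhds (show _ - ε / 4 < _ from sub_lt_self _ (by linarith)))
  obtain ⟨N, hN⟩ := eventually_atTop.mp (hev.and (hXT T hT2))
  refine ⟨N, fun n hn => ?_⟩
  obtain ⟨h1, h2⟩ := hN n hn.le
  have h0 : 0 ≤ ∫ r in Set.Ioi c0, (B n r - F r) ^ 2 * w r :=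
    setIntegral_nonneg measurableSet_Ioi fun r _ => mul_nonneg (sq_nonneg _) (hwn r)
  rw [Real.dist_eq, sub_zero, abs_of_nonneg h0]
  have := hE n
  simp only [id] at hT1
  linarith

theorem PSeq.compact {L C c0 W : ℝ} {w : ℝ → ℝ} {c a lam : ℕ → ℝ} {h g s Q : ℕ → ℝ → ℝ}
    (S : PSeq L C c0 W w c a lam h g s Q) :
    ∃ φ : ℕ → ℕ, StrictMono φ ∧ ∃ lam0 F G, IsLim c0 lam0 w F G ∧
      Tendsto (fun n => lam (φ n)) atTop (nhds lam0) ∧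
      Tendsto (fun n => ∫ r in Set.Ioi c0,
      ((if r ∈ Set.Ioo (c (φ n)) (a (φ n)) then
          h (φ n) r * s (φ n) r * √(Q (φ n) r / w r) else 0) - F r) ^ 2 * w r)
      atTop (nhds 0) := by
  obtain ⟨p, -, φ, hφ, hp⟩ := ((isCompact_Icc (a := (0 : ℝ)) (b := L)).prod
    (isCompact_Icc (a := (0 : ℝ)) (b := L))).tendsto_subseq
    (x := fun n => (lam n, g n (c n))) (fun n =>
      ⟨⟨(S.pre n).lam_pos.le, (S.pre n).lam_le⟩,
       ⟨(S.pre n).gnn _ ⟨le_rfl, (S.pre n).hca.le⟩, (S.pre n).gle _ ⟨le_rfl, (S.pre n).hca.le⟩⟩⟩)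
  have hp1 := (continuous_fst.tendsto p).comp hp
  have hp2 := (continuous_snd.tendsto p).comp hp
  have S1 := S.comp hφ
  have hL : 0 ≤ L := ((S.pre 0).lam_pos.le.trans (S.pre 0).lam_le)
  obtain ⟨ψ, hψ, F, hFc, hF⟩ := aa_lite (fun n r =>
    if r ∈ Set.Ioo (c (φ n)) (a (φ n)) then h (φ n) r else 0) c0
    (fun n => if_neg fun hx => absurd hx.1 (not_lt.mpr (S.c0le _))) (by
      intro T
      obtain ⟨m, hm, M, hM⟩ := S1.loc (max T (c0 + 1))
      refine ⟨L / m, ?_⟩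
      filter_upwards [hM, S1.alim.eventually_gt_atTop (max T (c0 + 1)),
        S1.clim.eventually (gt_mem_nhds (show c0 < c0 + 1 by linarith))] with n h1 h2 h3 x hx y hy
      have h3' : c (φ n) < c0 + 1 := h3
      have P := S.pre (φ n)
      have e : ∀ x ≤ T, (if x ∈ Set.Ioo (c (φ n)) (a (φ n)) then h (φ n) x else 0)
          = h (φ n) (max x (c (φ n))) := by
        intro x hx
        by_cases hxc : c (φ n) < x
        · rw [if_pos ⟨hxc, by linarith [le_max_left T (c0 + 1)]⟩, max_eq_left hxc.le]
        · rw [if_neg (fun hh => hxc hh.1), max_eq_right (not_lt.mp hxc), P.hc0]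
      rw [e x hx, e y hy]
      have hmm : ∀ x ≤ T, max x (c (φ n)) ∈ Set.Icc (c (φ n)) (max T (c0 + 1)) := fun x hx =>
        ⟨le_max_right _ _, max_le_max hx h3'.le⟩
      refine (P.lip h2 hm (fun r hr => (h1 r hr).1) _ (hmm x hx) _ (hmm y hy)).trans ?_
      exact mul_le_mul_of_nonneg_left (abs_max_sub_max_le_abs x y (c (φ n))) (by positivity))
  have S2 := S1.comp hψ
  have hF0 : F c0 = 0 := by
    refine tendsto_nhds_unique (hF c0) ?_
    refine tendsto_const_nhds.congr fun n => ?_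
    exact (if_neg fun hx => absurd hx.1 (not_lt.mpr (S.c0le _))).symm
  obtain ⟨⟨G, hG⟩, hcr⟩ := S2.limit (hp1.comp hψ.tendsto_atTop) (hp2.comp hψ.tendsto_atTop) hFc hF0 (by
    intro r hr
    refine (hF r).congr' ?_
    filter_upwards [S2.clim.eventually (gt_mem_nhds hr), S2.alim.eventually_gt_atTop r] with n h1 h2
    exact if_pos ⟨h1, h2⟩)
  exact ⟨φ ∘ ψ, hφ.comp hψ, p.1, F, G, hG, hp1.comp hψ.tendsto_atTop, S2.l2 hG hcr⟩

theorem IsLim.lam_le {c0 l1 l2 : ℝ} {w F G F' G' : ℝ → ℝ} (wc : Continuous w)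
    (wpos : ∀ r, 0 < w r) (A : IsLim c0 l1 w F G) (B : IsLim c0 l2 w F' G') : l1 ≤ l2 := by
  by_contra hlt
  push Not at hlt
  set V : ℝ → ℝ := fun r => F r * G' r - G r * F' r with hV
  have hVc : Continuous V := (A.Fc.mul B.Gc).sub (A.Gc.mul B.Fc)
  have hVd : ∀ r, c0 < r → HasDerivAt V ((l1 - l2) * (w r * F r * F' r)) r := by
    intro r hr
    have := ((A.Fd r hr).mul (B.Gd r hr)).sub ((A.Gd r hr).mul (B.Fd r hr))
    refine this.congr_deriv ?_
    have := (wpos r).ne'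
    field_simp
    ring
  have hmono : StrictMonoOn V (Set.Ici c0) := by
    refine strictMonoOn_of_deriv_pos (convex_Ici c0) hVc.continuousOn fun r hr => ?_
    rw [interior_Ici] at hr
    rw [(hVd r hr).deriv]
    have h1 := A.Fpos r hr
    have h2 := B.Fpos r hr
    have h3 := wpos r
    have h4 : 0 < l1 - l2 := by linarith
    positivity
  have hV0 : V c0 = 0 := by simp [hV, A.F0, B.F0]
  set δ := V (c0 + 1) with hδ
  have hδp : 0 < δ := by
    rw [← hV0]
    exact hmono (Set.mem_Ici.mpr le_rfl) (Set.mem_Ici.mpr (by linarith)) (by linarith)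
  have hF2 : IntegrableOn (fun x => F x ^ 2 * w x) (Set.Ioi c0) := by
    by_contra hne
    have := integral_undef hne
    rw [A.norm] at this
    norm_num at this
  obtain ⟨K, hK⟩ := B.en
  -- pointwise lower bound
  have hlow : ∀ r, c0 + 1 ≤ r → 2 * δ ≤ F r ^ 2 * w r + G' r ^ 2 / w r := by
    intro r hr
    have h1 : δ ≤ V r := hmono.monotoneOn (Set.mem_Ici.mpr (by linarith))
      (Set.mem_Ici.mpr (by linarith)) hr
    have h2 : 0 ≤ G r * F' r := mul_nonneg (A.Gnn r (by linarith)) (B.Fpos r (by linarith)).le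
    have h3 : 2 * (F r * G' r) ≤ F r ^ 2 * w r + G' r ^ 2 / w r := by
      have hw := wpos r
      have : F r ^ 2 * w r + G' r ^ 2 / w r - 2 * (F r * G' r) = (F r * w r - G' r) ^ 2 / w r := by
        field_simp
        ring
      have : 0 ≤ (F r * w r - G' r) ^ 2 / w r := by positivity
      linarith
    simp only [hV] at h1
    linarith
  have c1 : Continuous fun r => F r ^ 2 * w r := (A.Fc.pow 2).mul wc
  have c2 : Continuous fun r => G' r ^ 2 / w r := (B.Gc.pow 2).div wc fun x => (wpos x).ne'
  have hbig : ∀ T, c0 + 1 ≤ T → (T - (c0 + 1)) * (2 * δ) ≤ 1 + K := by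
    intro T hT
    have h1 : ∫ r in (c0 + 1)..T, (2 * δ) ≤ ∫ r in (c0 + 1)..T, (F r ^ 2 * w r + G' r ^ 2 / w r) :=
      intervalIntegral.integral_mono_on hT (by simp)
        ((c1.add c2).intervalIntegrable _ _) fun x hx => hlow x hx.1
    rw [intervalIntegral.integral_const, smul_eq_mul] at h1
    have h2 : ∫ r in (c0 + 1)..T, (F r ^ 2 * w r + G' r ^ 2 / w r)
        ≤ ∫ r in c0..T, (F r ^ 2 * w r + G' r ^ 2 / w r) := by
      refine intervalIntegral.integral_mono_interval (by linarith) hT le_rfl ?_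
        ((c1.add c2).intervalIntegrable _ _)
      refine Eventually.of_forall fun r => ?_
      have := wpos r
      simp only [Pi.zero_apply]
      positivity
    rw [intervalIntegral.integral_add (f := fun r => F r ^ 2 * w r) (g := fun r => G' r ^ 2 / w r) (a := c0) (c1.intervalIntegrable _ _)
      (c2.intervalIntegrable _ _)] at h2
    have h3 := hK T (by linarith)
    have h4 : ∫ r in c0..T, F r ^ 2 * w r ≤ 1 := by
      rw [← A.norm, intervalIntegral.integral_of_le (by linarith)]
      refine setIntegral_mono_set hF2 (Eventually.of_forall fun r => ?_)
        (Eventually.of_forall fun x hx => hx.1)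
      have := wpos r
      simp only [Pi.zero_apply]
      positivity
    linarith
  have h5 := hbig (c0 + 1 + (|1 + K| + 1) / (2 * δ)) (by
    have : 0 < (|1 + K| + 1) / (2 * δ) := by positivity
    linarith)
  have h6 : (c0 + 1 + (|1 + K| + 1) / (2 * δ) - (c0 + 1)) * (2 * δ) = |1 + K| + 1 := by
    field_simp; ring
  linarith [le_abs_self (1 + K)]

theorem IsLim.unique {c0 l1 l2 : ℝ} {w F G F' G' : ℝ → ℝ} (wc : Continuous w)
    (wpos : ∀ r, 0 < w r) (A : IsLim c0 l1 w F G) (B : IsLim c0 l2 w F' G') :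
    l1 = l2 ∧ ∀ r, c0 ≤ r → F r = F' r := by
  have hl : l1 = l2 := le_antisymm (A.lam_le wc wpos B) (B.lam_le wc wpos A)
  subst hl
  refine ⟨rfl, ?_⟩
  set V : ℝ → ℝ := fun r => F r * G' r - G r * F' r with hV
  have hVc : Continuous V := (A.Fc.mul B.Gc).sub (A.Gc.mul B.Fc)
  have hVd : ∀ r, c0 < r → HasDerivAt V 0 r := by
    intro r hr
    have := ((A.Fd r hr).mul (B.Gd r hr)).sub ((A.Gd r hr).mul (B.Fd r hr))
    refine this.congr_deriv ?_
    have := (wpos r).ne'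
    field_simp
    ring
  have hV0 : V c0 = 0 := by simp [hV, A.F0, B.F0]
  have hVz : ∀ r, c0 ≤ r → V r = 0 := by
    intro r hr
    have := intervalIntegral.integral_eq_sub_of_hasDerivAt_of_le hr hVc.continuousOn
      (fun x hx => hVd x hx.1) (by simp)
    simp only [intervalIntegral.integral_zero] at this
    linarith
  -- the quotient is constant
  have hqd : ∀ r ∈ Set.Ioi c0, HasDerivAt (fun r => F r / F' r) 0 r := by
    intro r hr
    have hp := (B.Fpos r hr).ne'
    have := (A.Fd r hr).div (B.Fd r hr) hp
    refine this.congr_deriv ?_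
    have h1 := hVz r (le_of_lt hr)
    simp only [hV] at h1
    have h2 := (wpos r).ne'
    field_simp
    linarith
  have hconst : ∀ r ∈ Set.Ioi c0, F r / F' r = F (c0 + 1) / F' (c0 + 1) := by
    intro r hr
    exact isOpen_Ioi.is_const_of_deriv_eq_zero (isPreconnected_Ioi)
      (fun x hx => (hqd x hx).differentiableAt.differentiableWithinAt)
      (fun x hx => (hqd x hx).deriv) hr (show c0 + 1 ∈ Set.Ioi c0 by simp)
  set q := F (c0 + 1) / F' (c0 + 1) with hq
  have hqp : 0 < q := div_pos (A.Fpos _ (by linarith)) (B.Fpos _ (by linarith))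
  have hFq : ∀ r, c0 < r → F r = q * F' r := by
    intro r hr
    rw [← hconst r hr, div_mul_cancel₀ _ (B.Fpos r hr).ne']
  have hq1 : q = 1 := by
    have h1 := A.norm
    have : ∫ r in Set.Ioi c0, F r ^ 2 * w r = ∫ r in Set.Ioi c0, q ^ 2 * (F' r ^ 2 * w r) := by
      refine setIntegral_congr_fun measurableSet_Ioi fun r hr => ?_
      simp only [hFq r hr]; ring
    rw [this, integral_const_mul, B.norm, mul_one] at h1
    nlinarith
  intro r hr
  rcases hr.eq_or_lt with rfl | hr
  · rw [A.F0, B.F0]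
  · rw [hFq r hr, hq1, one_mul]

/-- the normalizing constant -/
noncomputable def ZFun (N : ℕ) (a : ℝ) : ℝ := ∫ ρ in Set.Ioo (-a) a, sFun a ρ ^ ((N : ℝ) / 2 - 1)

/-- the weight without cutoff -/
noncomputable def QFun (N : ℕ) (a r : ℝ) : ℝ := sFun a r ^ ((N : ℝ) / 2 - 1) / ZFun N a

theorem sFun_cont (a : ℝ) : Continuous (sFun a) := by
  unfold sFun; fun_prop

theorem sFun_pos {a r : ℝ} (ha : 0 < a) (h1 : -a < r) (h2 : r < a) : 0 < sFun a r := by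
  have : r ^ 2 / a ^ 2 < 1 := by
    rw [div_lt_one (by positivity)]
    nlinarith
  unfold sFun; linarith

theorem sFun_le_one (a r : ℝ) : sFun a r ≤ 1 := by
  have : 0 ≤ r ^ 2 / a ^ 2 := by positivity
  unfold sFun; linarith

theorem sFun_deriv (a r : ℝ) : HasDerivAt (sFun a) (-(2 * r / a ^ 2)) r := by
  have := (((hasDerivAt_id r).pow 2).div_const (a ^ 2)).const_sub 1
  refine this.congr_deriv ?_
  simp

theorem spow_cont (N : ℕ) (hN : 3 ≤ N) (a : ℝ) :
    Continuous fun r => sFun a r ^ ((N : ℝ) / 2 - 1) := by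
  refine (sFun_cont a).rpow_const fun x => Or.inr ?_
  have : (3 : ℝ) ≤ N := by exact_mod_cast hN
  linarith

theorem ZFun_pos (N : ℕ) (hN : 3 ≤ N) {a : ℝ} (ha : 0 < a) : 0 < ZFun N a := by
  unfold ZFun
  rw [← integral_Ioc_eq_integral_Ioo, ← intervalIntegral.integral_of_le (by linarith)]
  refine intervalIntegral.intervalIntegral_pos_of_pos_on ((spow_cont N hN a).intervalIntegrable _ _)
    (fun x hx => Real.rpow_pos_of_pos (sFun_pos ha hx.1 hx.2) _) (by linarith)

theorem QFun_cont (N : ℕ) (hN : 3 ≤ N) (a : ℝ) : Continuous (QFun N a) :=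
  (spow_cont N hN a).div_const _

theorem QFun_pos (N : ℕ) (hN : 3 ≤ N) {a r : ℝ} (ha : 0 < a) (h1 : -a < r) (h2 : r < a) :
    0 < QFun N a r :=
  div_pos (Real.rpow_pos_of_pos (sFun_pos ha h1 h2) _) (ZFun_pos N hN ha)

theorem QFun_int (N : ℕ) (hN : 3 ≤ N) {a : ℝ} (ha : 0 < a) :
    ∫ r in (-a)..a, QFun N a r = 1 := by
  unfold QFun
  rw [intervalIntegral.integral_div, intervalIntegral.integral_of_le (by linarith),
    integral_Ioc_eq_integral_Ioo]
  exact div_self (ZFun_pos N hN ha).ne'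

theorem PFun_deriv (N : ℕ) {a r : ℝ} (ha : 0 < a) (h1 : -a < r) (h2 : r < a) :
    HasDerivAt (fun r => sFun a r * QFun N a r) (-((N : ℝ) * r / a ^ 2 * QFun N a r)) r := by
  have hs := sFun_pos ha h1 h2
  have hd := sFun_deriv a r
  have := hd.mul ((hd.rpow_const (p := (N : ℝ) / 2 - 1) (Or.inl hs.ne')).div_const (ZFun N a))
  refine this.congr_deriv ?_
  have e : sFun a r ^ ((N : ℝ) / 2 - 1 - 1) * sFun a r = sFun a r ^ ((N : ℝ) / 2 - 1) := by
    rw [← Real.rpow_add_one hs.ne']; congr 1; ring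
  unfold QFun
  rw [← e]
  ring

theorem pre_of_ode {N : ℕ} (hN : 3 ≤ N) {a c lam L ε : ℝ} {h : ℝ → ℝ} (ha : 0 < a) (hc1 : -a < c)
    (hca : c < a) (hlam : 0 < lam) (hlamL : lam ≤ L) (hε : 0 < ε) (hNa : 2 * ε ≤ N / a ^ 2)
    (hcont : ContinuousOn h (Set.Icc c a))
    (hC2 : ContDiffOn ℝ 2 h (Set.Ioc c a))
    (hpos : ∀ r ∈ Set.Ioc c a, 0 < h r)
    (hbc : h c = 0)
    (hode : ∀ r ∈ Set.Ioo c a,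
      sFun a r * deriv (deriv h) r - ((N : ℝ) * r / a ^ 2) * deriv h r = -lam * h r)
    (hnorm : ∫ r in Set.Ioo c a, (h r) ^ 2 * wFun N a r = 1) :
    ∃ g, Pre L ((1 + L / ε) / ε) c a lam h g (sFun a) (QFun N a) := by
  set k : ℝ → ℝ := Set.IccExtend hca.le ((Set.Icc c a).restrict h) with hk
  have hkc : Continuous k := (continuousOn_iff_continuous_restrict.mp hcont).Icc_extend'
  have hkeq : ∀ r ∈ Set.Icc c a, k r = h r := fun r hr => by
    rw [hk, Set.IccExtend_of_mem _ _ hr]; rfl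
  have hsc := sFun_cont a
  have hQc := QFun_cont N hN a
  have hQp : ∀ r ∈ Set.Ico c a, 0 < QFun N a r := fun r hr =>
    QFun_pos N hN ha (hc1.trans_le hr.1) hr.2
  have hsp : ∀ r ∈ Set.Ico c a, 0 < sFun a r := fun r hr =>
    sFun_pos ha (hc1.trans_le hr.1) hr.2
  have hsa : sFun a a = 0 := by
    unfold sFun; rw [div_self (by positivity)]; simp
  have hQa : QFun N a a = 0 := by
    unfold QFun
    have : (3 : ℝ) ≤ N := by exact_mod_cast hN
    rw [hsa, Real.zero_rpow (by linarith), zero_div]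
  have hQnn : ∀ r ∈ Set.Icc c a, 0 ≤ QFun N a r := by
    intro r hr
    rcases hr.2.eq_or_lt with rfl | h2
    · exact hQa.ge
    · exact (hQp r ⟨hr.1, h2⟩).le
  have hknn : ∀ r ∈ Set.Icc c a, 0 ≤ k r := by
    intro r hr
    rw [hkeq r hr]
    rcases hr.1.eq_or_lt with rfl | h2
    · exact hbc.ge
    · exact (hpos r ⟨h2, hr.2⟩).le
  have hQk : Continuous fun r => QFun N a r * k r := hQc.mul hkc
  set g : ℝ → ℝ := fun r => lam * ∫ x in r..a, QFun N a x * k x with hg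
  have hgd : ∀ r, HasDerivAt g (-lam * (QFun N a r * k r)) r := by
    intro r
    have h1 := ((hQk.integral_hasStrictDerivAt a r).hasDerivAt.const_mul (-lam))
    refine h1.congr_of_eventuallyEq (Eventually.of_forall fun x => ?_)
    simp only [hg]
    rw [intervalIntegral.integral_symm]; ring
  have hgc : Continuous g := continuous_iff_continuousAt.mpr fun r => (hgd r).continuousAt
  have hga : g a = 0 := by simp [hg]
  set P : ℝ → ℝ := fun r => sFun a r * QFun N a r with hP
  have hPc : Continuous P := hsc.mul hQc
  have hPa : P a = 0 := by simp [hP, hsa]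
  have hPp : ∀ r ∈ Set.Ico c a, 0 < P r := fun r hr => mul_pos (hsp r hr) (hQp r hr)
  have hPQ : ∀ r ∈ Set.Icc c a, P r ≤ QFun N a r := fun r hr =>
    mul_le_of_le_one_left (hQnn r hr) (sFun_le_one a r)
  -- the derivative of `h`
  have hC2' : ContDiffOn ℝ (1 + 1) h (Set.Ioo c a) := by
    rw [one_add_one_eq_two]; exact hC2.mono Set.Ioo_subset_Ioc_self
  rw [contDiffOn_succ_iff_deriv_of_isOpen isOpen_Ioo] at hC2'
  have hh1 : ∀ r ∈ Set.Ioo c a, HasDerivAt h (deriv h r) r := fun r hr =>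
    (hC2'.1.differentiableAt (isOpen_Ioo.mem_nhds hr)).hasDerivAt
  have hh2 : ∀ r ∈ Set.Ioo c a, HasDerivAt (deriv h) (deriv (deriv h) r) r := fun r hr =>
    ((hC2'.2.2.differentiableOn one_ne_zero).differentiableAt (isOpen_Ioo.mem_nhds hr)).hasDerivAt
  set u := derivWithin h (Set.Ioc c a) with hu
  have huc : ContinuousOn u (Set.Ioc c a) :=
    hC2.continuousOn_derivWithin (uniqueDiffOn_Ioc c a) (by norm_num)
  have hueq : ∀ r ∈ Set.Ioo c a, u r = deriv h r := fun r hr =>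
    derivWithin_of_mem_nhds (mem_of_superset (isOpen_Ioo.mem_nhds hr) Set.Ioo_subset_Ioc_self)
  have hPu : ∀ r ∈ Set.Ioo c a, P r * deriv h r = g r := by
    intro r hr
    have hd : ∀ x ∈ Set.Ioo r a, HasDerivAt (fun x => P x * u x - g x) 0 x := by
      intro x hx
      have hx' : x ∈ Set.Ioo c a := ⟨hr.1.trans hx.1, hx.2⟩
      have h1 : HasDerivAt u (deriv (deriv h) x) x := by
        refine (hh2 x hx').congr_of_eventuallyEq ?_
        filter_upwards [isOpen_Ioo.mem_nhds hx'] with y hy using hueq y hy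
      have h2 := ((PFun_deriv N ha (hc1.trans hx'.1) hx'.2).mul h1).sub (hgd x)
      refine h2.congr_deriv ?_
      rw [hueq x hx', hkeq x ⟨hx'.1.le, hx'.2.le⟩]
      have := hode x hx'
      linear_combination QFun N a x * this
    have hcc : ContinuousOn (fun x => P x * u x - g x) (Set.Icc r a) :=
      (hPc.continuousOn.mul (huc.mono fun x hx => ⟨hr.1.trans_le hx.1, hx.2⟩)).sub hgc.continuousOn
    have := intervalIntegral.integral_eq_sub_of_hasDerivAt_of_le hr.2.le hcc hd (by simp)
    simp only [intervalIntegral.integral_zero, hPa, hga, hueq r hr] at this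
    linarith
  have hhd : ∀ r ∈ Set.Ioo c a, HasDerivAt h (g r / P r) r := by
    intro r hr
    refine (hh1 r hr).congr_deriv ?_
    rw [← hPu r hr, mul_div_cancel_left₀ _ (hPp r ⟨hr.1.le, hr.2⟩).ne']
  have hkd : ∀ r ∈ Set.Ioo c a, HasDerivAt k (g r / P r) r := by
    intro r hr
    refine (hhd r hr).congr_of_eventuallyEq ?_
    filter_upwards [isOpen_Ioo.mem_nhds hr] with y hy using hkeq y ⟨hy.1.le, hy.2.le⟩
  have hgnn : ∀ r ∈ Set.Icc c a, 0 ≤ g r := fun r hr =>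
    mul_nonneg hlam.le (intervalIntegral.integral_nonneg hr.2 fun x hx =>
      mul_nonneg (hQnn x ⟨hr.1.trans hx.1, hx.2⟩) (hknn x ⟨hr.1.trans hx.1, hx.2⟩))
  have hk2Q : Continuous fun r => k r ^ 2 * QFun N a r := (hkc.pow 2).mul hQc
  have hconv : ∀ T, c ≤ T → T ≤ a →
      ∫ r in T..a, h r ^ 2 * QFun N a r = ∫ r in T..a, k r ^ 2 * QFun N a r := by
    intro T h1 h2
    refine intervalIntegral.integral_congr fun x hx => ?_
    rw [Set.uIcc_of_le h2] at hx
    simp only [hkeq x ⟨h1.trans hx.1, hx.2⟩]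
  have hnormh : ∫ r in c..a, h r ^ 2 * QFun N a r = 1 := by
    rw [← hnorm, intervalIntegral.integral_of_le hca.le, integral_Ioc_eq_integral_Ioo]
    refine setIntegral_congr_fun measurableSet_Ioo fun r hr => ?_
    have : |r| < a := abs_lt.mpr ⟨hc1.trans hr.1, hr.2⟩
    simp only [wFun, if_pos this, QFun, ZFun]
  have hnormk : ∫ r in c..a, k r ^ 2 * QFun N a r = 1 := by
    rw [← hconv c le_rfl hca.le, hnormh]
  have hk2nn : ∀ r ∈ Set.Icc c a, 0 ≤ k r ^ 2 * QFun N a r := fun r hr =>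
    mul_nonneg (sq_nonneg _) (hQnn r hr)
  have hmono : ∀ f : ℝ → ℝ, Continuous f → (∀ r ∈ Set.Icc c a, 0 ≤ f r) → ∀ T, c ≤ T → T ≤ a →
      ∫ r in T..a, f r ≤ ∫ r in c..a, f r := by
    intro f hf hf0 T h1 h2
    refine intervalIntegral.integral_mono_interval h1 h2 le_rfl ?_ (hf.intervalIntegrable _ _)
    filter_upwards [ae_restrict_mem measurableSet_Ioc] with x hx
    exact hf0 x ⟨hx.1.le, hx.2⟩
  have hQ1 : ∫ r in c..a, QFun N a r ≤ 1 := by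
    rw [← QFun_int N hN ha]
    refine intervalIntegral.integral_mono_interval hc1.le hca.le le_rfl ?_
      (hQc.intervalIntegrable _ _)
    filter_upwards [ae_restrict_mem measurableSet_Ioc] with x hx
    rcases hx.2.eq_or_lt with rfl | h2
    · exact hQa.ge
    · exact (QFun_pos N hN ha hx.1 h2).le
  have hgle : ∀ r ∈ Set.Icc c a, g r ≤ L := by
    intro r hr
    have h1 := hmono _ hQk (fun x hx => mul_nonneg (hQnn x hx) (hknn x hx)) r hr.1 hr.2
    have h2 : ∫ x in c..a, QFun N a x * k x
        ≤ ∫ x in c..a, (1 / 2) * (QFun N a x + k x ^ 2 * QFun N a x) := by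
      refine intervalIntegral.integral_mono_on hca.le (hQk.intervalIntegrable _ _)
        ((continuous_const.mul (hQc.add hk2Q)).intervalIntegrable _ _) fun x hx => ?_
      nlinarith [mul_nonneg (hQnn x hx) (sq_nonneg (k x - 1))]
    rw [intervalIntegral.integral_const_mul, intervalIntegral.integral_add
      (hQc.intervalIntegrable _ _) (hk2Q.intervalIntegrable _ _), hnormk] at h2
    have h3 : ∫ x in r..a, QFun N a x * k x ≤ 1 := by linarith
    calc g r ≤ lam * 1 := mul_le_mul_of_nonneg_left h3 hlam.le
      _ ≤ L := by linarith
  -- tail bound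
  have htail : ∫ r in c..a, r ^ 2 * (k r ^ 2 * QFun N a r) ≤ (1 + L / ε) / ε := by
    have hcr : Continuous fun r : ℝ => r ^ 2 * (k r ^ 2 * QFun N a r) := (continuous_pow 2).mul hk2Q
    have hΦ := intervalIntegral.integral_le_sub_of_hasDeriv_right_of_le hca.le
      (g := fun r => -(r * k r ^ 2 * P r) + 1 / ε * (g r * k r))
      (g' := fun r => -((1 * k r ^ 2 + r * (2 * k r * (g r / P r))) * P r
          + r * k r ^ 2 * (-((N : ℝ) * r / a ^ 2 * QFun N a r)))
        + 1 / ε * (-lam * (QFun N a r * k r) * k r + g r * (g r / P r)))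
      (φ := fun r => ε * (r ^ 2 * (k r ^ 2 * QFun N a r)) - (1 + lam / ε) * (k r ^ 2 * QFun N a r))
      (by
        refine Continuous.continuousOn ?_
        exact ((continuous_id.mul (hkc.pow 2)).mul hPc).neg.add
          (continuous_const.mul (hgc.mul hkc)))
      (fun r hr => by
        refine HasDerivAt.hasDerivWithinAt ?_
        have hk2 : HasDerivAt (fun r => k r ^ 2) (2 * k r * (g r / P r)) r := by
          refine ((hkd r hr).pow 2).congr_deriv ?_
          simp
        exact ((((hasDerivAt_id r).mul hk2).mul
          (PFun_deriv N ha (hc1.trans hr.1) hr.2)).neg).add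
          (((hgd r).mul (hkd r hr)).const_mul (1 / ε)))
      (Continuous.integrableOn_Icc ((continuous_const.mul hcr).sub (continuous_const.mul hk2Q)))
      (fun r hr => by
        have hr' : r ∈ Set.Icc c a := ⟨hr.1.le, hr.2.le⟩
        have p := hPp r ⟨hr.1.le, hr.2⟩
        have pq := hPQ r hr'
        have e1 : 0 ≤ (ε * (r * k r) * P r - g r) ^ 2 / (ε * P r) := by positivity
        have e2 : (ε * (r * k r) * P r - g r) ^ 2 / (ε * P r)
            = ε * (r * k r) ^ 2 * P r - 2 * (r * k r) * g r + 1 / ε * (g r * (g r / P r)) := by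
          field_simp
          ring
        have e3 : r * (2 * k r * (g r / P r)) * P r = 2 * (r * k r) * g r := by
          field_simp
        have e4 : 0 ≤ ((N : ℝ) / a ^ 2 - 2 * ε) * ((r * k r) ^ 2 * QFun N a r) :=
          mul_nonneg (by linarith) (mul_nonneg (sq_nonneg _) (hQnn r hr'))
        have e5 : 0 ≤ (ε * (r * k r) ^ 2 + k r ^ 2) * (QFun N a r - P r) :=
          mul_nonneg (by positivity) (by linarith)
        have e6 : r * k r ^ 2 * (-((N : ℝ) * r / a ^ 2 * QFun N a r))
          = - ((N : ℝ) / a ^ 2 * ((r * k r) ^ 2 * QFun N a r)) := by ring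
        have e7 : lam / ε * (k r ^ 2 * QFun N a r) = 1 / ε * (lam * (QFun N a r * k r) * k r) := by
          ring
        have e8 : (1 * k r ^ 2 + r * (2 * k r * (g r / P r))) * P r
            = k r ^ 2 * P r + 2 * (r * k r) * g r := by rw [← e3]; ring
        have e9 : r ^ 2 * (k r ^ 2 * QFun N a r) = (r * k r) ^ 2 * QFun N a r := by ring
        rw [e2] at e1
        have e10 : 1 / ε * (-lam * (QFun N a r * k r) * k r + g r * (g r / P r))
          = 1 / ε * (g r * (g r / P r)) - lam / ε * (k r ^ 2 * QFun N a r) := by ring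
        rw [e6, e8, e9, e10]
        generalize 1 / ε * (g r * (g r / P r)) = X at *
        generalize lam / ε = Y at *
        generalize (N : ℝ) / a ^ 2 = U at *
        nlinarith)
    have hsub : ∫ r in c..a, (ε * (r ^ 2 * (k r ^ 2 * QFun N a r))
          - (1 + lam / ε) * (k r ^ 2 * QFun N a r))
        = ε * (∫ r in c..a, r ^ 2 * (k r ^ 2 * QFun N a r)) - (1 + lam / ε) := by
      have i1 : IntervalIntegrable (fun r => ε * (r ^ 2 * (k r ^ 2 * QFun N a r))) volume c a :=
        (continuous_const.mul hcr).intervalIntegrable _ _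
      have i2 : IntervalIntegrable (fun r => (1 + lam / ε) * (k r ^ 2 * QFun N a r)) volume c a :=
        (continuous_const.mul hk2Q).intervalIntegrable _ _
      rw [intervalIntegral.integral_sub i1 i2, intervalIntegral.integral_const_mul,
        intervalIntegral.integral_const_mul, hnormk, mul_one]
    rw [hsub] at hΦ
    have hkc0 : k c = 0 := by rw [hkeq c ⟨le_rfl, hca.le⟩, hbc]
    simp only [hPa, hga, hkc0] at hΦ
    have h3 : lam / ε ≤ L / ε := by gcongr
    rw [le_div_iff₀ hε]
    linarith
  refine ⟨g, hca, hlam, hlamL, hcont, hgc.continuousOn, hsc.continuousOn, hQc.continuousOn, hhd,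
    fun r hr => ?_, hsp, hQp, fun r _ => sFun_le_one a r,
    fun r hr => hkeq r hr ▸ hknn r hr, hgnn, hbc, hgle, hnormh, ?_, ?_⟩
  · rw [← hkeq r ⟨hr.1.le, hr.2.le⟩]; exact hgd r
  · intro T hT0 h1 h2
    rw [hconv T h1 h2, le_div_iff₀ (by positivity), mul_comm, ← intervalIntegral.integral_const_mul]
    have hcr : Continuous fun r : ℝ => r ^ 2 * (k r ^ 2 * QFun N a r) := (continuous_pow 2).mul hk2Q
    have e1 : ∫ r in T..a, T ^ 2 * (k r ^ 2 * QFun N a r)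
        ≤ ∫ r in T..a, r ^ 2 * (k r ^ 2 * QFun N a r) := by
      refine intervalIntegral.integral_mono_on h2
        ((continuous_const.mul hk2Q).intervalIntegrable _ _) (hcr.intervalIntegrable _ _)
        fun x hx => ?_
      have := hk2nn x ⟨h1.trans hx.1, hx.2⟩
      have := hx.1
      gcongr
    have e2 := hmono _ hcr (fun x hx => mul_nonneg (sq_nonneg _) (hk2nn x hx)) T h1 h2
    linarith
  · intro T h1 h2
    have hgkd : ∀ r ∈ Set.Ioo c a,
        HasDerivAt (fun r => g r * k r) (g r ^ 2 / P r - lam * (k r ^ 2 * QFun N a r)) r := by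
      intro r hr
      refine ((hgd r).mul (hkd r hr)).congr_deriv ?_
      ring
    have hgPc : ContinuousOn (fun r => g r ^ 2 / P r) (Set.Icc c T) :=
      ((hgc.pow 2).continuousOn).div hPc.continuousOn
        fun r hr => (hPp r ⟨hr.1, hr.2.trans_lt h2⟩).ne'
    have hgPi : IntervalIntegrable (fun r => g r ^ 2 / P r) volume c T :=
      hgPc.intervalIntegrable_of_Icc h1
    have hli : ∀ x y, IntervalIntegrable (fun r => lam * (k r ^ 2 * QFun N a r)) volume x y :=
      fun x y => (continuous_const.mul hk2Q).intervalIntegrable _ _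
    have e1 := intervalIntegral.integral_eq_sub_of_hasDerivAt_of_le h1
      (hgc.mul hkc).continuousOn (fun r hr => hgkd r ⟨hr.1, hr.2.trans h2⟩) (hgPi.sub (hli c T))
    rw [intervalIntegral.integral_sub hgPi (hli c T)] at e1
    have e2 := intervalIntegral.integral_le_sub_of_hasDeriv_right_of_le h2.le
      (g := fun r => g r * k r) (g' := fun r => g r ^ 2 / P r - lam * (k r ^ 2 * QFun N a r))
      (φ := fun r => -(lam * (k r ^ 2 * QFun N a r)))
      (hgc.mul hkc).continuousOn
      (fun r hr => (hgkd r ⟨h1.trans_lt hr.1, hr.2⟩).hasDerivWithinAt)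
      ((continuous_const.mul hk2Q).neg.integrableOn_Icc)
      (fun r hr => by
        have p := hPp r ⟨(h1.trans_lt hr.1).le, hr.2⟩
        have : 0 ≤ g r ^ 2 / P r := by positivity
        linarith)
    rw [intervalIntegral.integral_neg] at e2
    have e3 := intervalIntegral.integral_add_adjacent_intervals (hli c T) (hli T a)
    rw [intervalIntegral.integral_const_mul (a := c) (b := a), hnormk] at e3
    have hkc0 : k c = 0 := by rw [hkeq c ⟨le_rfl, hca.le⟩, hbc]
    simp only [Pi.mul_apply, hkc0, hga] at e1 e2
    show ∫ r in c..T, g r ^ 2 / P r ≤ L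
    linarith

theorem wInf_pos {α : ℝ} (hα : 0 < α) (r : ℝ) : 0 < wInf α r := by
  unfold wInf; positivity

theorem wInf_cont (α : ℝ) : Continuous (wInf α) := by
  unfold wInf; fun_prop

theorem wInf_le {α : ℝ} (hα : 0 < α) (r : ℝ) : wInf α r ≤ (Real.sqrt (2 * Real.pi) * α)⁻¹ := by
  unfold wInf
  refine mul_le_of_le_one_right (by positivity) (Real.exp_le_one_iff.mpr ?_)
  rw [neg_div]
  exact neg_nonpos.mpr (by positivity)

theorem wInf_deriv (α r : ℝ) : HasDerivAt (wInf α) (-(r / α ^ 2) * wInf α r) r := by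
  have h1 : HasDerivAt (fun r : ℝ => -r ^ 2 / (2 * α ^ 2)) (-(r / α ^ 2)) r := by
    refine (((hasDerivAt_pow 2 r).neg).div_const (2 * α ^ 2)).congr_deriv ?_
    by_cases h : α = 0
    · simp [h]
    · field_simp; simp
  refine (h1.exp.const_mul (Real.sqrt (2 * Real.pi) * α)⁻¹).congr_deriv ?_
  unfold wInf; ring

theorem lim_facts {α : ℝ} (hα : 0 < α) {a : ℕ → ℝ}
    (hlima : Tendsto (fun N : ℕ => a N / Real.sqrt ((N : ℝ) - 1)) atTop (nhds α)) :
    Tendsto a atTop atTop ∧ Tendsto (fun N : ℕ => (N : ℝ) / a N ^ 2) atTop (nhds (1 / α ^ 2)) := by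
  have hN : Tendsto (fun N : ℕ => (N : ℝ) - 1) atTop atTop :=
    tendsto_atTop_add_const_right _ _ tendsto_natCast_atTop_atTop
  constructor
  · have h1 := (hlima.pos_mul_atTop hα (Real.tendsto_sqrt_atTop.comp hN))
    refine h1.congr' ?_
    filter_upwards [hN.eventually_gt_atTop 0] with N h
    have := Real.sqrt_pos.mpr h
    simp only [Function.comp]
    field_simp
  · have h2 : Tendsto (fun N : ℕ => 1 + ((N : ℝ) - 1)⁻¹) atTop (nhds (1 + 0)) :=
      tendsto_const_nhds.add (tendsto_inv_atTop_zero.comp hN)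
    rw [add_zero] at h2
    have h1 := h2.div (hlima.pow 2) (by positivity)
    refine h1.congr' ?_
    filter_upwards [hN.eventually_gt_atTop 0] with N h
    simp only [Pi.div_apply]
    rw [div_pow, Real.sq_sqrt h.le]
    field_simp
    ring

theorem s_lim {a : ℕ → ℝ} (ha : Tendsto a atTop atTop) (r : ℝ) :
    Tendsto (fun N => sFun (a N) r) atTop (nhds 1) := by
  unfold sFun
  have : Tendsto (fun N => r ^ 2 / a N ^ 2) atTop (nhds 0) :=
    ((tendsto_pow_atTop (two_ne_zero)).comp ha).const_div_atTop _
  simpa using tendsto_const_nhds.sub this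

theorem spow_lim {α : ℝ} {a : ℕ → ℝ} (ha : Tendsto a atTop atTop)
    (hNa : Tendsto (fun N : ℕ => (N : ℝ) / a N ^ 2) atTop (nhds (1 / α ^ 2))) (r : ℝ) :
    Tendsto (fun N : ℕ => sFun (a N) r ^ ((N : ℝ) / 2 - 1)) atTop
      (nhds (Real.exp (-r ^ 2 / (2 * α ^ 2)))) := by
  have h1 : Tendsto (fun N : ℕ => (N : ℝ) * (-(r ^ 2 / a N ^ 2))) atTop (nhds (-r ^ 2 / α ^ 2)) := by
    have := hNa.const_mul (-r ^ 2)
    rw [mul_one_div] at this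
    exact this.congr fun N => by ring
  have h2 := Real.tendsto_one_add_pow_exp_of_tendsto h1
  have h3 := (h2.sqrt).div (s_lim ha r) one_ne_zero
  have e : √(Real.exp (-r ^ 2 / α ^ 2)) / 1 = Real.exp (-r ^ 2 / (2 * α ^ 2)) := by
    rw [div_one, ← Real.exp_half]
    congr 1
    ring
  rw [e] at h3
  refine h3.congr' ?_
  filter_upwards [(s_lim ha r).eventually_const_lt zero_lt_one] with N hs
  simp only [Pi.div_apply]
  have : 1 + -(r ^ 2 / a N ^ 2) = sFun (a N) r := by unfold sFun; ring
  rw [this, Real.sqrt_eq_rpow, ← Real.rpow_natCast, ← Real.rpow_mul hs.le, Real.rpow_sub hs,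
    Real.rpow_one]
  congr 2
  ring

theorem Z_lim {α : ℝ} (hα : 0 < α) {a : ℕ → ℝ} (ha : Tendsto a atTop atTop)
    (hNa : Tendsto (fun N : ℕ => (N : ℝ) / a N ^ 2) atTop (nhds (1 / α ^ 2))) :
    Tendsto (fun N : ℕ => ZFun N (a N)) atTop (nhds (Real.sqrt (2 * Real.pi) * α)) := by
  have hG : ∫ r : ℝ, Real.exp (-r ^ 2 / (2 * α ^ 2)) = Real.sqrt (2 * Real.pi) * α := by
    have := integral_gaussian (1 / (2 * α ^ 2))
    have e : ∀ r : ℝ, -(1 / (2 * α ^ 2)) * r ^ 2 = -r ^ 2 / (2 * α ^ 2) := fun r => by ring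
    simp only [e] at this
    rw [this]
    have e2 : Real.pi / (1 / (2 * α ^ 2)) = (2 * Real.pi) * α ^ 2 := by field_simp
    rw [e2, Real.sqrt_mul (by positivity), Real.sqrt_sq hα.le]
  have hb : (0 : ℝ) < 1 / (12 * α ^ 2) := by positivity
  have hZ : ∀ N : ℕ, ZFun N (a N) = ∫ r : ℝ, (Set.Ioo (-(a N)) (a N)).indicator
      (fun r => sFun (a N) r ^ ((N : ℝ) / 2 - 1)) r := fun N => by
    rw [integral_indicator measurableSet_Ioo]; rfl
  simp only [hZ]
  rw [← hG]
  have hev : ∀ᶠ N : ℕ in atTop, 1 / (2 * α ^ 2) < (N : ℝ) / a N ^ 2 := by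
    refine hNa.eventually_const_lt ?_
    exact one_div_lt_one_div_of_lt (by positivity) (by nlinarith [pow_pos hα 2])
  refine tendsto_integral_filter_of_dominated_convergence
    (fun r => Real.exp (-(1 / (12 * α ^ 2)) * r ^ 2)) ?_ ?_ (integrable_exp_neg_mul_sq hb) ?_
  · filter_upwards [eventually_ge_atTop 3] with N hN
    exact ((spow_cont N hN (a N)).aestronglyMeasurable).indicator measurableSet_Ioo
  · filter_upwards [eventually_ge_atTop 3, ha.eventually_gt_atTop 0, hev] with N hN hpos hN2
    refine Eventually.of_forall fun r => ?_
    by_cases hr : r ∈ Set.Ioo (-(a N)) (a N)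
    · rw [Set.indicator_of_mem hr]
      have hs := sFun_pos hpos hr.1 hr.2
      rw [Real.norm_of_nonneg (Real.rpow_nonneg hs.le _)]
      have hN3 : (3 : ℝ) ≤ N := by exact_mod_cast hN
      have h1 : sFun (a N) r ≤ Real.exp (-(r ^ 2 / a N ^ 2)) := Real.one_sub_le_exp_neg _
      calc sFun (a N) r ^ ((N : ℝ) / 2 - 1)
          ≤ Real.exp (-(r ^ 2 / a N ^ 2)) ^ ((N : ℝ) / 2 - 1) :=
            Real.rpow_le_rpow hs.le h1 (by linarith)
        _ = Real.exp (-(r ^ 2 / a N ^ 2) * ((N : ℝ) / 2 - 1)) := by rw [← Real.exp_mul]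
        _ ≤ _ := by
          refine Real.exp_le_exp.mpr ?_
          have h2 : 1 / (12 * α ^ 2) ≤ ((N : ℝ) / 2 - 1) / a N ^ 2 := by
            have h3 : (N : ℝ) / 6 / a N ^ 2 ≤ ((N : ℝ) / 2 - 1) / a N ^ 2 := by
              gcongr; linarith
            have h4 : (N : ℝ) / 6 / a N ^ 2 = (N : ℝ) / a N ^ 2 / 6 := by ring
            have h5 : 1 / (12 * α ^ 2) = 1 / (2 * α ^ 2) / 6 := by ring
            rw [h5]; linarith
          have h6 := mul_le_mul_of_nonneg_right h2 (sq_nonneg r)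
          have h7 : -(r ^ 2 / a N ^ 2) * ((N : ℝ) / 2 - 1)
            = - (((N : ℝ) / 2 - 1) / a N ^ 2 * r ^ 2) := by ring
          linarith
    · rw [Set.indicator_of_notMem hr, norm_zero]
      exact (Real.exp_pos _).le
  · refine Eventually.of_forall fun r => ?_
    refine (spow_lim ha hNa r).congr' ?_
    filter_upwards [ha.eventually_gt_atTop |r|] with N hN
    have hm : r ∈ Set.Ioo (-(a N)) (a N) := abs_lt.mp hN
    rw [Set.indicator_of_mem hm]

theorem Q_lim {α : ℝ} (hα : 0 < α) {a : ℕ → ℝ} (ha : Tendsto a atTop atTop)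
    (hNa : Tendsto (fun N : ℕ => (N : ℝ) / a N ^ 2) atTop (nhds (1 / α ^ 2))) (r : ℝ) :
    Tendsto (fun N : ℕ => QFun N (a N) r) atTop (nhds (wInf α r)) := by
  have := (spow_lim ha hNa r).div (Z_lim hα ha hNa) (by positivity)
  unfold wInf QFun
  rw [inv_mul_eq_div]
  exact this

theorem sQ_bounds (N : ℕ) (hN : 3 ≤ N) {a r M : ℝ} (hr : |r| ≤ M) (hM : M < a) :
    sFun a M * QFun N a M ≤ sFun a r * QFun N a r ∧ QFun N a r ≤ QFun N a 0 := by
  have hM0 : 0 ≤ M := (abs_nonneg r).trans hr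
  have ha : 0 < a := hM0.trans_lt hM
  have hp : (0 : ℝ) ≤ (N : ℝ) / 2 - 1 := by
    have : (3 : ℝ) ≤ N := by exact_mod_cast hN
    linarith
  have h1 := sFun_pos ha (by linarith : -a < M) hM
  have h2 : sFun a M ≤ sFun a r := by
    have : r ^ 2 ≤ M ^ 2 := sq_le_sq' (abs_le.mp hr).1 (abs_le.mp hr).2
    unfold sFun; gcongr
  have h3 : sFun a r ≤ sFun a 0 := by
    have := sFun_le_one a r
    simpa [sFun] using this
  have hZ := ZFun_pos N hN ha
  have hQ : QFun N a M ≤ QFun N a r :=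
    div_le_div_of_nonneg_right (Real.rpow_le_rpow h1.le h2 hp) hZ.le
  exact ⟨mul_le_mul h2 hQ (QFun_pos N hN ha (by linarith) hM).le (h1.le.trans h2),
    div_le_div_of_nonneg_right (Real.rpow_le_rpow (h1.le.trans h2) h3 hp) hZ.le⟩

theorem islim_props {α c0 lam : ℝ} (hα : 0 < α) {F G : ℝ → ℝ} (A : IsLim c0 lam (wInf α) F G) :
    ContDiffOn ℝ 2 F (Set.Ioi c0) ∧ ∀ r ∈ Set.Ioi c0,
      deriv (deriv F) r - (r / α ^ 2) * deriv F r = -lam * F r := by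
  have hd : ∀ r ∈ Set.Ioi c0, deriv F r = G r / wInf α r := fun r hr => (A.Fd r hr).deriv
  have hdd : ∀ r ∈ Set.Ioi c0, HasDerivAt (deriv F) (r / α ^ 2 * (G r / wInf α r) - lam * F r) r := by
    intro r hr
    have h1 := (A.Gd r hr).div (wInf_deriv α r) (wInf_pos hα r).ne'
    refine (h1.congr_of_eventuallyEq ?_).congr_deriv ?_
    · filter_upwards [isOpen_Ioi.mem_nhds hr] with y hy using hd y hy
    · have := (wInf_pos hα r).ne'
      field_simp
      ring
  constructor
  · have e2 : (2 : WithTop ℕ∞) = 1 + 1 := by norm_num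
    rw [e2, contDiffOn_succ_iff_deriv_of_isOpen isOpen_Ioi]
    refine ⟨fun r hr => (A.Fd r hr).differentiableAt.differentiableWithinAt, by simp, ?_⟩
    have e1 : (1 : WithTop ℕ∞) = 0 + 1 := by norm_num
    rw [e1, contDiffOn_succ_iff_deriv_of_isOpen isOpen_Ioi]
    refine ⟨fun r hr => (hdd r hr).differentiableAt.differentiableWithinAt, by simp, ?_⟩
    rw [contDiffOn_zero]
    have hc : Continuous fun r => r / α ^ 2 * (G r / wInf α r) - lam * F r :=
      ((continuous_id.div_const _).mul (A.Gc.div (wInf_cont α) fun r => (wInf_pos hα r).ne')).sub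
        (continuous_const.mul A.Fc)
    exact hc.continuousOn.congr fun r hr => (hdd r hr).deriv
  · intro r hr
    rw [(hdd r hr).deriv, hd r hr]
    ring

/-- convergence of the first Dirichlet eigenvalue problem on spherical caps to the
first Dirichlet eigenvalue problem of the Ornstein–Uhlenbeck operator on a half-line. -/
theorem dirichlet_eigen_tendsto
    (α R : ℝ) (hα : 0 < α) (a θ lam : ℕ → ℝ) (h : ℕ → ℝ → ℝ)
    (ha : ∀ N, 2 ≤ N → 0 < a N)
    (hθ : ∀ N, 2 ≤ N → θ N ∈ Set.Ioo 0 Real.pi)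
    (hlima : Tendsto (fun N : ℕ => a N / Real.sqrt ((N : ℝ) - 1)) atTop (nhds α))
    (hlimc : Tendsto (fun N : ℕ => a N * Real.cos (θ N)) atTop (nhds (α * R)))
    (hsup : ∃ C : ℝ, ∀ N, 2 ≤ N → (a N ^ 2 - α ^ 2 * ((N : ℝ) - 2)) / a N ≤ C)
    (hge : ∀ N, 2 ≤ N → α * R ≤ a N * Real.cos (θ N))
    (hlampos : ∀ N, 2 ≤ N → 0 < lam N)
    (hlambdd : ∃ C : ℝ, ∀ N, 2 ≤ N → lam N ≤ C)
    (hcont : ∀ N, 2 ≤ N → ContinuousOn (h N) (Set.Icc (a N * Real.cos (θ N)) (a N)))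
    (hC2 : ∀ N, 2 ≤ N → ContDiffOn ℝ 2 (h N) (Set.Ioc (a N * Real.cos (θ N)) (a N)))
    (hpos : ∀ N, 2 ≤ N → ∀ r ∈ Set.Ioc (a N * Real.cos (θ N)) (a N), 0 < h N r)
    (hbc : ∀ N, 2 ≤ N → h N (a N * Real.cos (θ N)) = 0)
    (hode : ∀ N, 2 ≤ N → ∀ r ∈ Set.Ioo (a N * Real.cos (θ N)) (a N),
      sFun (a N) r * deriv (deriv (h N)) r - ((N : ℝ) * r / a N ^ 2) * deriv (h N) r
        = -lam N * h N r)
    (hnorm : ∀ N, 2 ≤ N →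
      ∫ r in Set.Ioo (a N * Real.cos (θ N)) (a N), (h N r) ^ 2 * wFun N (a N) r = 1) :
    ∃ lamInf : ℝ, 0 < lamInf ∧ Tendsto lam atTop (nhds lamInf) ∧
      ∃ hInf : ℝ → ℝ,
        ContinuousOn hInf (Set.Ici (α * R)) ∧
        ContDiffOn ℝ 2 hInf (Set.Ioi (α * R)) ∧
        (∀ r ∈ Set.Ioi (α * R), 0 < hInf r) ∧
        hInf (α * R) = 0 ∧
        (∀ r ∈ Set.Ioi (α * R),
          deriv (deriv hInf) r - (r / α ^ 2) * deriv hInf r = -lamInf * hInf r) ∧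
        (∫ r in Set.Ioi (α * R), hInf r ^ 2 * wInf α r) = 1 ∧
        Tendsto (fun N : ℕ =>
            ∫ r in Set.Ioi (α * R),
              ((if r ∈ Set.Ioo (a N * Real.cos (θ N)) (a N) then
                  h N r * sFun (a N) r * Real.sqrt (wFun N (a N) r / wInf α r)
                else 0) - hInf r) ^ 2 * wInf α r)
          atTop (nhds 0) := by
  obtain ⟨ha1, hNa⟩ := lim_facts hα hlima
  obtain ⟨L, hL⟩ := hlambdd
  have hε : (0 : ℝ) < 1 / (4 * α ^ 2) := by positivity
  set ε : ℝ := 1 / (4 * α ^ 2) with hεdef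
  have hev : ∀ᶠ N : ℕ in atTop, 3 ≤ N ∧ 2 * ε ≤ (N : ℝ) / a N ^ 2 := by
    have h1 : ∀ᶠ N : ℕ in atTop, 2 * ε < (N : ℝ) / a N ^ 2 := by
      refine hNa.eventually_const_lt ?_
      have e : 2 * ε = 1 / (2 * α ^ 2) := by rw [hεdef]; field_simp; norm_num
      rw [e]
      exact one_div_lt_one_div_of_lt (by positivity) (by nlinarith [pow_pos hα 2])
    filter_upwards [h1, eventually_ge_atTop 3] with N h2 h3 using ⟨h3, h2.le⟩
  have hpre : ∀ N : ℕ, 3 ≤ N ∧ 2 * ε ≤ (N : ℝ) / a N ^ 2 →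
      ∃ g, Pre L ((1 + L / ε) / ε) (a N * Real.cos (θ N)) (a N) (lam N) (h N) g
        (sFun (a N)) (QFun N (a N)) := by
    rintro N ⟨h3, h4⟩
    have h2 : 2 ≤ N := by omega
    have hap := ha N h2
    have hc1 : Real.cos (θ N) < 1 := by
      have := Real.cos_lt_cos_of_nonneg_of_le_pi le_rfl (hθ N h2).2.le (hθ N h2).1
      simpa using this
    have hc2 : -1 < Real.cos (θ N) := by
      have := Real.cos_lt_cos_of_nonneg_of_le_pi (hθ N h2).1.le le_rfl (hθ N h2).2
      simpa using this
    exact pre_of_ode h3 hap (by nlinarith) (by nlinarith) (hlampos N h2) (hL N h2) hε h4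
      (hcont N h2) (hC2 N h2) (hpos N h2) (hbc N h2) (hode N h2) (hnorm N h2)
  have key : ∀ ns : ℕ → ℕ, Tendsto ns atTop atTop → ∃ ms : ℕ → ℕ, ∃ lam0 F G,
      IsLim (α * R) lam0 (wInf α) F G ∧ Tendsto (fun n => lam (ns (ms n))) atTop (nhds lam0) ∧
      Tendsto (fun n =>
        ∫ r in Set.Ioi (α * R),
          ((if r ∈ Set.Ioo (a (ns (ms n)) * Real.cos (θ (ns (ms n)))) (a (ns (ms n))) then
            h (ns (ms n)) r * sFun (a (ns (ms n))) r *
              Real.sqrt (wFun (ns (ms n)) (a (ns (ms n))) r / wInf α r)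
            else 0) - F r) ^ 2 * wInf α r) atTop (nhds 0) := by
    intro ns hns
    obtain ⟨k0, hk0⟩ := eventually_atTop.mp (hns.eventually hev)
    have hk : ∀ n, 3 ≤ ns (n + k0) ∧ 2 * ε ≤ ((ns (n + k0) : ℕ) : ℝ) / a (ns (n + k0)) ^ 2 :=
      fun n => hk0 _ (Nat.le_add_left _ _)
    have hms : Tendsto (fun n => ns (n + k0)) atTop atTop :=
      hns.comp (tendsto_add_atTop_nat k0)
    choose g hg using fun n => hpre _ (hk n)
    have S : PSeq L ((1 + L / ε) / ε) (α * R) ((Real.sqrt (2 * Real.pi) * α)⁻¹) (wInf α)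
        (fun n => a (ns (n + k0)) * Real.cos (θ (ns (n + k0)))) (fun n => a (ns (n + k0)))
        (fun n => lam (ns (n + k0))) (fun n => h (ns (n + k0))) g
        (fun n => sFun (a (ns (n + k0)))) (fun n => QFun (ns (n + k0)) (a (ns (n + k0)))) :=
      { pre := hg
        c0le := fun n => hge _ (by have := (hk n).1; omega)
        clim := hlimc.comp hms
        alim := ha1.comp hms
        wc := wInf_cont α
        wpos := wInf_pos hα
        wle := wInf_le hα
        loc := by
          intro T
          set M := max |α * R| |T| with hM
          have h1 : Tendsto (fun N : ℕ => sFun (a N) M * QFun N (a N) M) atTop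
              (nhds (1 * wInf α M)) := (s_lim ha1 M).mul (Q_lim hα ha1 hNa M)
          have hw := wInf_pos hα M
          refine ⟨wInf α M / 2, by linarith, wInf α 0 + 1, ?_⟩
          have e1 := h1.eventually_const_lt (show wInf α M / 2 < 1 * wInf α M by linarith)
          have e2 := (Q_lim hα ha1 hNa 0).eventually_lt_const (lt_add_one (wInf α 0))
          have e3 := ha1.eventually_gt_atTop M
          filter_upwards [hms.eventually e1, hms.eventually e2, hms.eventually e3] with n f1 f2 f3
          intro r hr
          have hc := hge (ns (n + k0)) (by have := (hk n).1; omega)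
          have hrM : |r| ≤ M := by
            refine abs_le.mpr ⟨?_, hr.2.trans ((le_abs_self T).trans (le_max_right _ _))⟩
            have := hr.1
            have h5 := neg_abs_le (α * R)
            have h6 : |α * R| ≤ M := le_max_left _ _
            linarith
          obtain ⟨b1, b2⟩ := sQ_bounds _ (hk n).1 hrM f3
          exact ⟨f1.le.trans b1, b2.trans f2.le⟩
        slim := fun r => (s_lim ha1 r).comp hms
        Qlim := fun r => (Q_lim hα ha1 hNa r).comp hms }
    obtain ⟨φ, _, lam0, F, G, hI, hl, hcvg⟩ := S.compact
    refine ⟨fun n => φ n + k0, lam0, F, G, hI, hl, hcvg.congr fun n => ?_⟩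
    refine setIntegral_congr_fun measurableSet_Ioi fun r hr => ?_
    by_cases hm : r ∈ Set.Ioo (a (ns (φ n + k0)) * Real.cos (θ (ns (φ n + k0)))) (a (ns (φ n + k0)))
    · have hap := ha (ns (φ n + k0)) (by have := (hk (φ n)).1; omega)
      have hr1 : |r| < a (ns (φ n + k0)) := by
        refine abs_lt.mpr ⟨?_, hm.2⟩
        have := hm.1
        nlinarith [Real.neg_one_le_cos (θ (ns (φ n + k0)))]
      have e : wFun (ns (φ n + k0)) (a (ns (φ n + k0))) r
          = QFun (ns (φ n + k0)) (a (ns (φ n + k0))) r := by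
        simp only [wFun, if_pos hr1, QFun, ZFun]
      simp only [if_pos hm, e]
    · simp only [if_neg hm]
  obtain ⟨ms0, lam0, F, G, hI, -, -⟩ := key id tendsto_id
  obtain ⟨hC, hO⟩ := islim_props hα hI
  refine ⟨lam0, hI.lam_pos, ?_, F, hI.Fc.continuousOn, hC, fun r hr => hI.Fpos r hr, hI.F0, hO,
    hI.norm, ?_⟩
  · refine tendsto_of_subseq_tendsto fun ns hns => ?_
    obtain ⟨ms, lam1, F1, G1, hI1, hl1, -⟩ := key ns hns
    obtain ⟨e, -⟩ := IsLim.unique (wInf_cont α) (wInf_pos hα) hI1 hI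
    exact ⟨ms, e ▸ hl1⟩
  · refine tendsto_of_subseq_tendsto fun ns hns => ?_
    obtain ⟨ms, lam1, F1, G1, hI1, -, hcvg⟩ := key ns hns
    obtain ⟨-, e⟩ := IsLim.unique (wInf_cont α) (wInf_pos hα) hI1 hI
    refine ⟨ms, hcvg.congr fun n => ?_⟩
    refine setIntegral_congr_fun measurableSet_Ioi fun r hr => ?_
    simp only [e r (le_of_lt hr)]
end
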